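/- arXiv:2009.03007 — 4 statements merged into one kernel-verified Lean document; each statement's English description precedes it below -/
import Mathlib

section
/- (Tits' deformation theorem, Theorem 1.1) Let G be a finite group, r ∈ ℕ, and a : G × G × G → ℂ[x₁,…,x_r] a family of polynomial structure constants such that for every q ∈ ℂ^r the multiplication T_g ·_q T_h = Σ_{w∈G} a_{g,h,w}(q) T_w makes the free ℂ-module with basis {T_g : g ∈ G} into an associative unital ℂ-algebra ℋ(G,q) with unit T_e. Suppose there exists q⁰ ∈ ℂ^r with ℋ(G,q⁰) = ℂ[G], i.e. a_{g,h,w}(q⁰) = 1 if w = gh and 0 otherwise. Then there exists a polynomial P ∈ ℂ[x₁,…,x_r] such that for every q ∈ ℂ^r the following are equivalent: (i) P(q) ≠ 0; (ii) ℋ(G,q) is a semisimple algebra; (iii) ℋ(G,q) is isomorphic as a ℂ-algebra to the group algebra ℂ[G]. -/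
/- STATEMENT 2 (Tits' deformation theorem, Theorem 1.1): Let `G` be a finite group and
`a : G × G × G → ℂ[x₁, …, x_r]` a family of polynomial structure constants such that for
every `q ∈ ℂ^r` the multiplication `T_g ·_q T_h = Σ_w a_{g,h,w}(q) T_w` makes the free
ℂ-module with basis `{T_g : g ∈ G}` into an associative unital ℂ-algebra `ℋ(G, q)` with
unit `T_e`, and such that `ℋ(G, q⁰) = ℂ[G]` for some `q⁰ ∈ ℂ^r`.  Then there is a
polynomial `P` such that for every `q ∈ ℂ^r`: `P(q) ≠ 0` ⟺ `ℋ(G, q)` is semisimple ⟺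
`ℋ(G, q) ≅ ℂ[G]` as ℂ-algebras. -/

/-- The ring structure on the free module `G →₀ ℂ` determined by an associative unital
ℂ-bilinear multiplication with unit `T_e = Finsupp.single 1 1`. -/
noncomputable def heckeRing {G : Type*} [One G]
    (mul : (G →₀ ℂ) →ₗ[ℂ] (G →₀ ℂ) →ₗ[ℂ] (G →₀ ℂ))
    (hassoc : ∀ x y z : G →₀ ℂ, mul (mul x y) z = mul x (mul y z))
    (honel : ∀ x : G →₀ ℂ, mul (Finsupp.single 1 1) x = x)
    (honer : ∀ x : G →₀ ℂ, mul x (Finsupp.single 1 1) = x) : Ring (G →₀ ℂ) :=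
  { (inferInstance : AddCommGroup (G →₀ ℂ)) with
    mul := fun x y => mul x y
    one := Finsupp.single 1 1
    mul_assoc := hassoc
    one_mul := honel
    mul_one := honer
    left_distrib := fun x y z => map_add (mul x) y z
    right_distrib := fun x y z => by
      show mul (x + y) z = mul x z + mul y z
      rw [map_add]; rfl
    zero_mul := fun x => by show mul 0 x = 0; rw [map_zero]; rfl
    mul_zero := fun x => map_zero (mul x) }

section TitsAux
open Module

variable {G : Type*} [Fintype G]

/-- Gram matrix of the trace form, from structure constants. -/
def titsM {R : Type*} [CommRing R] (c : G → G → G → R) : Matrix G G R :=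
  Matrix.of fun g h => ∑ w, ∑ u, c g h w * c w u u

def titsB {R : Type*} [CommRing R] (c : G → G → G → R) : Matrix G G R :=
  Matrix.of fun g h => ∑ u, ∑ w, c u h w * c g w u

noncomputable def titsE [DecidableEq G] (c : G → G → G → ℂ) : Matrix G G ℂ :=
  (titsB c * (titsM c)⁻¹).transpose

noncomputable def titsC [DecidableEq G] (c : G → G → G → ℂ) : Matrix G G ℂ :=
  Matrix.of fun g h => ∑ w, ∑ u, ∑ v, c g h w * (c w u v * titsE c u v)

noncomputable def titsS [DecidableEq G] (c : G → G → G → ℂ) : Matrix G G ℂ :=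
  (titsC c * (titsM c)⁻¹).transpose

noncomputable def titsF [DecidableEq G] (p : Polynomial ℂ) (c : G → G → G → ℂ) : ℂ :=
  (Polynomial.aeval (titsS c) p).trace

variable {A : Type*} [Ring A] [Algebra ℂ A]

noncomputable def titsTau (A : Type*) [Ring A] [Algebra ℂ A] : A →ₗ[ℂ] ℂ :=
  LinearMap.trace ℂ A ∘ₗ (LinearMap.mul ℂ A)

lemma titsTau_apply (x : A) : titsTau A x = LinearMap.trace ℂ A (LinearMap.mulLeft ℂ x) := rfl

lemma tits_trace_sum [DecidableEq G] (b : Basis G ℂ A) (f : A →ₗ[ℂ] A) :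
    LinearMap.trace ℂ A f = ∑ u, b.repr (f (b u)) u := by
  rw [LinearMap.trace_eq_matrix_trace ℂ b]
  simp [Matrix.trace, LinearMap.toMatrix_apply]

lemma titsM_apply [DecidableEq G] (b : Basis G ℂ A) (c : G → G → G → ℂ)
    (hc : ∀ g h, b g * b h = ∑ w, c g h w • b w) (g h : G) :
    titsM c g h = titsTau A (b g * b h) := by
  rw [hc, map_sum]
  simp only [titsM, Matrix.of_apply, map_smul, titsTau_apply, tits_trace_sum b,
    LinearMap.mulLeft_apply, hc, map_sum, Finsupp.coe_finsetSum, Finset.sum_apply, Basis.repr_self]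
  simp [Finset.mul_sum, Finsupp.single_apply]

lemma titsB_apply [DecidableEq G] (b : Basis G ℂ A) (c : G → G → G → ℂ)
    (hc : ∀ g h, b g * b h = ∑ w, c g h w • b w) (g h : G) :
    titsB c g h = LinearMap.trace ℂ A (LinearMap.mulLeft ℂ (b g) ∘ₗ LinearMap.mulRight ℂ (b h)) := by
  simp only [titsB, Matrix.of_apply, tits_trace_sum b, LinearMap.comp_apply,
    LinearMap.mulLeft_apply, LinearMap.mulRight_apply, hc, map_sum, Finsupp.coe_finsetSum,
    Finset.sum_apply, mul_smul_comm]
  simp [Finsupp.single_apply]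

lemma tits_det_iff [DecidableEq G] (b : Basis G ℂ A) (c : G → G → G → ℂ)
    (hc : ∀ g h, b g * b h = ∑ w, c g h w • b w) :
    (titsM c).det ≠ 0 ↔ ∀ y : A, (∀ x, titsTau A (x * y) = 0) → y = 0 := by
  have key : ∀ (v : G → ℂ) (g : G),
      (titsM c).mulVec v g = titsTau A (b g * ∑ h, v h • b h) := by
    intro v g
    simp only [Matrix.mulVec, dotProduct, titsM_apply b c hc, Finset.mul_sum, mul_smul_comm,
      map_sum, map_smul, smul_eq_mul]
    exact Finset.sum_congr rfl fun _ _ => mul_comm _ _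
  rw [Ne, ← Matrix.exists_mulVec_eq_zero_iff]
  push Not
  constructor
  · intro H y hy
    by_contra hne
    refine H (b.repr y) ?_ ?_
    · intro h0
      apply hne
      apply b.repr.injective
      ext g
      simpa using congrFun h0 g
    · funext g
      rw [key, b.sum_repr, hy]; rfl
  · intro H v hv h0
    apply hv
    have := H (∑ h, v h • b h) (by
      intro x
      have h1 : titsTau A ∘ₗ (LinearMap.mulRight ℂ (∑ h, v h • b h)) = 0 := by
        apply b.ext
        intro g
        simpa [key] using congrFun h0 g
      exact LinearMap.congr_fun h1 x)
    funext g
    exact Fintype.linearIndependent_iff.1 b.linearIndependent v this g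

lemma tits_semisimple_of_det [DecidableEq G] (b : Basis G ℂ A) (c : G → G → G → ℂ)
    (hc : ∀ g h, b g * b h = ∑ w, c g h w • b w) (hd : (titsM c).det ≠ 0) :
    IsSemisimpleRing A := by
  have : FiniteDimensional ℂ A := b.finiteDimensional_of_finite
  have : IsArtinianRing A := IsArtinianRing.of_finite ℂ A
  rw [IsArtinianRing.isSemisimpleRing_iff_jacobson]
  rw [tits_det_iff b c hc] at hd
  rw [eq_bot_iff]
  intro y hy
  refine (Submodule.mem_bot _).2 (hd y fun x => ?_)
  have hxy : x * y ∈ Ring.jacobson A := Ideal.mul_mem_left _ x hy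
  obtain ⟨n, hn⟩ := IsArtinianRing.isNilpotent_jacobson_bot (R := A)
  have hnil : IsNilpotent (x * y) := by
    refine ⟨n, ?_⟩
    have h2 : (x * y) ∈ (⊥ : Ideal A).jacobson := by
      rwa [Ideal.jacobson_bot]
    have := Ideal.pow_mem_pow h2 n
    rw [hn] at this
    simpa using this
  rw [titsTau_apply]
  apply (LinearMap.isNilpotent_trace_of_isNilpotent _).eq_zero
  exact hnil.map (Algebra.lmul ℂ A)

/-- Uniqueness: the matrix E. -/
lemma titsE_eq [DecidableEq G] (b : Basis G ℂ A) (c : G → G → G → ℂ)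
    (hc : ∀ g h, b g * b h = ∑ w, c g h w • b w) (hd : (titsM c).det ≠ 0) (e : A →ₗ[ℂ] A)
    (he : ∀ x y, titsTau A (e x * y) =
      LinearMap.trace ℂ A (LinearMap.mulLeft ℂ x ∘ₗ LinearMap.mulRight ℂ y)) :
    titsE c = LinearMap.toMatrix b b e := by
  have h1 : (LinearMap.toMatrix b b e).transpose * titsM c = titsB c := by
    ext g h
    rw [titsB_apply b c hc, ← he, ← b.sum_repr (e (b g)), Finset.sum_mul, map_sum, Matrix.mul_apply]
    refine Finset.sum_congr rfl fun u _ => ?_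
    rw [smul_mul_assoc, map_smul, titsM_apply b c hc, Matrix.transpose_apply,
      LinearMap.toMatrix_apply, smul_eq_mul]
  rw [titsE, ← h1, Matrix.mul_assoc, Matrix.mul_nonsing_inv _ hd.isUnit, Matrix.mul_one,
    Matrix.transpose_transpose]

lemma titsS_eq [DecidableEq G] (b : Basis G ℂ A) (c : G → G → G → ℂ)
    (hc : ∀ g h, b g * b h = ∑ w, c g h w • b w) (hd : (titsM c).det ≠ 0) (e s : A →ₗ[ℂ] A)
    (hE : titsE c = LinearMap.toMatrix b b e)
    (hs : ∀ x y, titsTau A (s x * y) =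
      LinearMap.trace ℂ A (e ∘ₗ LinearMap.mulLeft ℂ (x * y))) :
    titsS c = LinearMap.toMatrix b b s := by
  have hC : ∀ g h, titsC c g h = LinearMap.trace ℂ A (e ∘ₗ LinearMap.mulLeft ℂ (b g * b h)) := by
    intro g h
    simp only [titsC, Matrix.of_apply, hE, tits_trace_sum b, LinearMap.comp_apply,
      LinearMap.mulLeft_apply, hc g h, Finset.sum_mul, smul_mul_assoc, hc, map_sum, map_smul,
      LinearMap.toMatrix_apply, Finsupp.coe_finsetSum, Finset.sum_apply, Finset.mul_sum,
      Finsupp.smul_apply, smul_eq_mul]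
    rw [Finset.sum_comm]
  have h1 : (LinearMap.toMatrix b b s).transpose * titsM c = titsC c := by
    ext g h
    rw [hC, ← hs, ← b.sum_repr (s (b g)), Finset.sum_mul, map_sum, Matrix.mul_apply]
    refine Finset.sum_congr rfl fun u _ => ?_
    rw [smul_mul_assoc, map_smul, titsM_apply b c hc, Matrix.transpose_apply,
      LinearMap.toMatrix_apply, smul_eq_mul]
  rw [titsS, ← h1, Matrix.mul_assoc, Matrix.mul_nonsing_inv _ hd.isUnit, Matrix.mul_one,
    Matrix.transpose_transpose]

lemma titsF_eq [DecidableEq G] (b : Basis G ℂ A) (c : G → G → G → ℂ) (s : A →ₗ[ℂ] A)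
    (hS : titsS c = LinearMap.toMatrix b b s) (p : Polynomial ℂ) :
    titsF p c = LinearMap.trace ℂ A (Polynomial.aeval s p) := by
  rw [titsF, hS, LinearMap.trace_eq_matrix_trace ℂ b]
  congr 1
  exact Polynomial.aeval_algHom_apply (LinearMap.toMatrixAlgEquiv b).toAlgHom s p

/-! ### products of matrix algebras -/

abbrev TitsPi {k : ℕ} (d : Fin k → ℕ) := ∀ i, Matrix (Fin (d i)) (Fin (d i)) ℂ

variable {k : ℕ} (d : Fin k → ℕ)

lemma titsPi_trace (f : TitsPi d →ₗ[ℂ] TitsPi d) :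
    LinearMap.trace ℂ _ f = ∑ i, ∑ j, ∑ l, f (Pi.single i (Matrix.single j l 1)) i j l := by
  have := tits_trace_sum (A := TitsPi d) (Pi.basis fun i => Matrix.stdBasis ℂ (Fin (d i)) (Fin (d i))) f
  rw [this, Fintype.sum_sigma]
  refine Finset.sum_congr rfl fun i _ => ?_
  rw [Fintype.sum_prod_type]
  refine Finset.sum_congr rfl fun j _ => Finset.sum_congr rfl fun l _ => ?_
  rw [Pi.basis_repr, Pi.basis_apply, Matrix.stdBasis_eq_single]
  rfl

lemma titsPi_tau (x : TitsPi d) : titsTau _ x = ∑ i, (d i : ℂ) * (x i).trace := by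
  rw [titsTau_apply, titsPi_trace]
  refine Finset.sum_congr rfl fun i _ => ?_
  simp [Matrix.trace, Matrix.mul_apply, Matrix.single_apply, Finset.mul_sum, Matrix.diag]

lemma titsPi_beta (x y : TitsPi d) :
    LinearMap.trace ℂ (TitsPi d) (LinearMap.mulLeft ℂ x ∘ₗ LinearMap.mulRight ℂ y)
      = ∑ i, (x i).trace * (y i).trace := by
  rw [titsPi_trace]
  refine Finset.sum_congr rfl fun i _ => ?_
  simp [Matrix.trace, Matrix.mul_apply, Matrix.single_apply, Finset.mul_sum, Matrix.diag,
    Finset.sum_mul, ite_and]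
  rw [Finset.sum_comm]

noncomputable def titsPiE : TitsPi d →ₗ[ℂ] TitsPi d where
  toFun x i := ((d i : ℂ)⁻¹ * (x i).trace) • 1
  map_add' x y := by funext i; simp [mul_add, add_smul]
  map_smul' r x := by funext i; simp [smul_smul]; ring_nf

noncomputable def titsPiS : TitsPi d →ₗ[ℂ] TitsPi d where
  toFun x i := ((d i : ℂ) ^ 2)⁻¹ • x i
  map_add' x y := by funext i; simp
  map_smul' r x := by funext i; simp [smul_smul, mul_comm]

lemma titsPi_E (hd : ∀ i, d i ≠ 0) (x y : TitsPi d) : titsTau _ (titsPiE d x * y) =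
    LinearMap.trace ℂ (TitsPi d) (LinearMap.mulLeft ℂ x ∘ₗ LinearMap.mulRight ℂ y) := by
  rw [titsPi_beta, titsPi_tau]
  refine Finset.sum_congr rfl fun i _ => ?_
  have : (d i : ℂ) ≠ 0 := by exact_mod_cast hd i
  simp [titsPiE]
  field_simp

lemma titsPi_S (hd : ∀ i, d i ≠ 0) (x y : TitsPi d) : titsTau _ (titsPiS d x * y) =
    LinearMap.trace ℂ (TitsPi d) (titsPiE d ∘ₗ LinearMap.mulLeft ℂ (x * y)) := by
  rw [titsPi_trace, titsPi_tau]
  refine Finset.sum_congr rfl fun i _ => ?_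
  have : (d i : ℂ) ≠ 0 := by exact_mod_cast hd i
  simp [titsPiE, titsPiS, Matrix.one_apply, -LinearMap.mulLeft_mul]
  generalize x i * y i = z
  have : ∀ j l : Fin (d i), (z * Matrix.single j l (1:ℂ)).trace = z l j := by
    intro j l
    rw [Matrix.trace_mul_single]
    exact one_smul _ _
  simp only [this]
  rw [← Finset.mul_sum, Matrix.trace]
  simp only [Matrix.diag_apply]
  field_simp

lemma titsPi_aeval (p : Polynomial ℂ) (x : TitsPi d) (i : Fin k) :
    Polynomial.aeval (titsPiS d) p x i = p.eval (((d i : ℂ) ^ 2)⁻¹) • x i := by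
  induction p using Polynomial.induction_on' with
  | add p q hp hq => simp [hp, hq, add_smul]
  | monomial n a =>
    have : ∀ n : ℕ, ((titsPiS d) ^ n) x i = (((d i : ℂ) ^ 2)⁻¹) ^ n • x i := by
      intro n
      induction n with
      | zero => simp
      | succ n ih =>
        rw [pow_succ']
        change ((d i : ℂ) ^ 2)⁻¹ • ((titsPiS d ^ n) x i) = _
        rw [ih, smul_smul, pow_succ' (((d i : ℂ) ^ 2)⁻¹)]
    simp [Polynomial.aeval_monomial, Polynomial.eval_monomial, this, smul_smul]

lemma titsPi_nondeg (hd : ∀ i, d i ≠ 0) (y : TitsPi d) (h : ∀ x, titsTau _ (x * y) = 0) :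
    y = 0 := by
  funext i
  ext j l
  have := h (Pi.single i (Matrix.single l j 1))
  rw [titsPi_tau, Finset.sum_eq_single i] at this
  · have h2 : (d i : ℂ) ≠ 0 := by exact_mod_cast hd i
    simpa [h2, Matrix.trace_single_mul] using this
  · intro i' _ hne
    simp [hne]
  · simp

lemma titsPi_F (hd : ∀ i, d i ≠ 0) [DecidableEq G] (b : Basis G ℂ (TitsPi d)) (c : G → G → G → ℂ)
    (hc : ∀ g h, b g * b h = ∑ w, c g h w • b w) :
    (titsM c).det ≠ 0 ∧
    ∀ p, titsF p c = ∑ i, (d i : ℂ) ^ 2 * p.eval (((d i : ℂ) ^ 2)⁻¹) := by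
  have h0 : (titsM c).det ≠ 0 := (tits_det_iff b c hc).2 (titsPi_nondeg d hd)
  refine ⟨h0, fun p => ?_⟩
  have hE := titsE_eq b c hc h0 _ (titsPi_E d hd)
  have hS := titsS_eq b c hc h0 _ _ hE (titsPi_S d hd)
  rw [titsF_eq b c _ hS, titsPi_trace]
  refine Finset.sum_congr rfl fun i _ => ?_
  simp only [titsPi_aeval]
  simp
  ring

lemma tits_semisimple [DecidableEq G] (b : Basis G ℂ A) (c : G → G → G → ℂ)
    (hc : ∀ g h, b g * b h = ∑ w, c g h w • b w) [IsSemisimpleRing A] :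
    (titsM c).det ≠ 0 ∧ ∃ (k : ℕ) (d : Fin k → ℕ), (∀ i, d i ≠ 0) ∧ (∀ i, d i ≤ Fintype.card G) ∧
      k ≤ Fintype.card G ∧
      Nonempty (A ≃ₐ[ℂ] TitsPi d) ∧
      ∀ p, titsF p c = ∑ i, (d i : ℂ) ^ 2 * p.eval (((d i : ℂ) ^ 2)⁻¹) := by
  have : FiniteDimensional ℂ A := b.finiteDimensional_of_finite
  obtain ⟨k, d, hd, ⟨φ⟩⟩ := IsSemisimpleRing.exists_algEquiv_pi_matrix_of_isAlgClosed ℂ A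
  have hd' : ∀ i, d i ≠ 0 := fun i => (hd i).ne
  have hcard : Fintype.card G = ∑ i, d i * d i := by
    rw [← Module.finrank_eq_card_basis b, φ.toLinearEquiv.finrank_eq, Module.finrank_pi_fintype]
    simp [Module.finrank_matrix]
  have := titsPi_F d hd' (b.map φ.toLinearEquiv) c (by
    intro g h
    simpa using congrArg φ (hc g h))
  refine ⟨this.1, k, d, hd', ?_, ?_, ⟨φ⟩, this.2⟩
  · intro i
    rw [hcard]
    exact (Nat.le_mul_self _).trans
      (Finset.single_le_sum (f := fun i => d i * d i) (fun _ _ => Nat.zero_le _) (Finset.mem_univ i))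
  · rw [hcard]
    calc k = ∑ i : Fin k, 1 := by simp
      _ ≤ _ := Finset.sum_le_sum fun i _ => Nat.mul_pos (Nat.pos_of_ne_zero (hd' i)) (Nat.pos_of_ne_zero (hd' i))

end TitsAux
section TitsAux2
open Module

variable {G : Type*} [Fintype G]

lemma tits_contOn [DecidableEq G] (c : ℂ → G → G → G → ℂ)
    (hc : ∀ g h w, Continuous fun t => c t g h w) (p : Polynomial ℂ) :
    ContinuousOn (fun t => titsF p (c t)) {t | (titsM (c t)).det ≠ 0} := by
  have hM : Continuous fun t => titsM (c t) := by
    refine continuous_matrix fun g h => ?_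
    simp only [titsM, Matrix.of_apply]
    fun_prop
  have hB : Continuous fun t => titsB (c t) := by
    refine continuous_matrix fun g h => ?_
    simp only [titsB, Matrix.of_apply]
    fun_prop
  have hI : ContinuousOn (fun t => (titsM (c t))⁻¹) {t | (titsM (c t)).det ≠ 0} := by
    simp only [Matrix.inv_def, Ring.inverse_eq_inv']
    exact (hM.matrix_det.continuousOn.inv₀ fun t ht => ht).smul hM.matrix_adjugate.continuousOn
  have hE : ContinuousOn (fun t => titsE (c t)) {t | (titsM (c t)).det ≠ 0} := by
    unfold titsE
    exact (continuous_id.matrix_transpose).comp_continuousOn (hB.continuousOn.mul hI)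
  have hC : ContinuousOn (fun t => titsC (c t)) {t | (titsM (c t)).det ≠ 0} := by
    have hE' : ∀ u v, ContinuousOn (fun t => titsE (c t) u v) {t | (titsM (c t)).det ≠ 0} :=
      fun u v => (continuous_id.matrix_elem u v).comp_continuousOn hE
    refine continuousOn_pi.2 fun g => continuousOn_pi.2 fun h => ?_
    simp only [titsC, Matrix.of_apply]
    refine continuousOn_finsetSum _ fun w _ => continuousOn_finsetSum _ fun u _ =>
      continuousOn_finsetSum _ fun v _ => ?_
    exact (hc _ _ _).continuousOn.mul ((hc _ _ _).continuousOn.mul (hE' _ _))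
  have hS : ContinuousOn (fun t => titsS (c t)) {t | (titsM (c t)).det ≠ 0} := by
    unfold titsS
    exact (continuous_id.matrix_transpose).comp_continuousOn (hC.mul hI)
  unfold titsF
  exact (continuous_id.matrix_trace).comp_continuousOn
    (p.continuous_aeval.comp_continuousOn hS)

lemma tits_equiv_of_count {k k' : ℕ} (d : Fin k → ℕ) (d' : Fin k' → ℕ)
    (h : ∀ n, (Finset.univ.filter fun i => d i = n).card
      = (Finset.univ.filter fun i => d' i = n).card) :
    Nonempty (TitsPi d ≃ₐ[ℂ] TitsPi d') := by
  have he : ∀ n, Nonempty ({i // d i = n} ≃ {i // d' i = n}) := by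
    intro n
    refine ⟨Fintype.equivOfCardEq ?_⟩
    rw [Fintype.card_subtype, Fintype.card_subtype, h]
  let σ : Fin k ≃ Fin k' := (Equiv.sigmaFiberEquiv d).symm.trans
    ((Equiv.sigmaCongrRight fun n => (he n).some).trans (Equiv.sigmaFiberEquiv d'))
  have hσ : ∀ i, d i = d' (σ i) := by
    intro i
    exact (((he (d i)).some) ⟨i, rfl⟩).2.symm
  have : d = fun i => d' (σ i) := funext hσ
  clear_value σ
  subst this
  exact ⟨AlgEquiv.piCongrLeft ℂ (fun i => Matrix (Fin (d' i)) (Fin (d' i)) ℂ) σ⟩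

/-- Indicator polynomial. -/
lemma tits_indicator (N n : ℕ) : ∃ p : Polynomial ℂ, ∀ m : ℕ, m ≠ 0 → m ≤ N →
    p.eval (((m : ℂ) ^ 2)⁻¹) = if m = n then 1 else 0 := by
  refine ⟨Lagrange.interpolate (Finset.Icc 1 N) (fun m : ℕ => ((m : ℂ) ^ 2)⁻¹)
    (fun m => if m = n then 1 else 0), fun m h0 hm => ?_⟩
  refine Lagrange.eval_interpolate_at_node (v := fun m : ℕ => ((m : ℂ) ^ 2)⁻¹)
    (fun m => if m = n then (1 : ℂ) else 0) ?_ (Finset.mem_Icc.2 ⟨Nat.pos_of_ne_zero h0, hm⟩)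
  intro x _ y _ hxy
  have h1 : ((x : ℂ) ^ 2) = (y : ℂ) ^ 2 := inv_injective hxy
  have h2 : x ^ 2 = y ^ 2 := by exact_mod_cast h1
  exact Nat.pow_left_injective (n := 2) (by norm_num) h2

lemma tits_F_indicator {k : ℕ} (d : Fin k → ℕ) (N n : ℕ) (p : Polynomial ℂ)
    (hp : ∀ m : ℕ, m ≠ 0 → m ≤ N → p.eval (((m : ℂ) ^ 2)⁻¹) = if m = n then 1 else 0)
    (hd : ∀ i, d i ≠ 0) (hN : ∀ i, d i ≤ N) :
    ∑ i, (d i : ℂ) ^ 2 * p.eval (((d i : ℂ) ^ 2)⁻¹)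
      = ((n ^ 2 * (Finset.univ.filter fun i => d i = n).card : ℕ) : ℂ) := by
  rw [Finset.card_filter]
  push_cast
  rw [Finset.mul_sum]
  refine Finset.sum_congr rfl fun i _ => ?_
  rw [hp _ (hd i) (hN i)]
  split_ifs with h <;> simp [h]

variable [One G]

/-- Type synonym carrying the deformed multiplication. -/
def TitsH (mul : (G →₀ ℂ) →ₗ[ℂ] (G →₀ ℂ) →ₗ[ℂ] (G →₀ ℂ))
    (_ : ∀ x y z : G →₀ ℂ, mul (mul x y) z = mul x (mul y z))
    (_ : ∀ x : G →₀ ℂ, mul (Finsupp.single 1 1) x = x)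
    (_ : ∀ x : G →₀ ℂ, mul x (Finsupp.single 1 1) = x) : Type _ := G →₀ ℂ

variable (mul : (G →₀ ℂ) →ₗ[ℂ] (G →₀ ℂ) →ₗ[ℂ] (G →₀ ℂ))
    (h1 : ∀ x y z : G →₀ ℂ, mul (mul x y) z = mul x (mul y z))
    (h2 : ∀ x : G →₀ ℂ, mul (Finsupp.single 1 1) x = x)
    (h3 : ∀ x : G →₀ ℂ, mul x (Finsupp.single 1 1) = x)

noncomputable instance : Ring (TitsH mul h1 h2 h3) := heckeRing mul h1 h2 h3

noncomputable instance titsHModule : Module ℂ (TitsH mul h1 h2 h3) :=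
  inferInstanceAs (Module ℂ (G →₀ ℂ))

noncomputable instance : Algebra ℂ (TitsH mul h1 h2 h3) :=
  Algebra.ofModule
    (fun r x y => by
      change mul (r • x) y = r • mul x y
      exact LinearMap.map_smul₂ mul r x y)
    (fun r x y => by
      change mul x (r • y) = r • mul x y
      exact map_smul (mul x) r y)

noncomputable def titsHEquiv : (G →₀ ℂ) ≃ₗ[ℂ] TitsH mul h1 h2 h3 where
  toFun x := x
  invFun x := x
  map_add' _ _ := rfl
  map_smul' _ _ := rfl
  left_inv _ := rfl
  right_inv _ := rfl

lemma titsHEquiv_mul (x y : G →₀ ℂ) :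
    titsHEquiv mul h1 h2 h3 (mul x y) = titsHEquiv mul h1 h2 h3 x * titsHEquiv mul h1 h2 h3 y := rfl

lemma titsHEquiv_one : titsHEquiv mul h1 h2 h3 (Finsupp.single 1 1) = 1 := rfl

noncomputable def titsHBasis : Basis G ℂ (TitsH mul h1 h2 h3) :=
  Finsupp.basisSingleOne.map (titsHEquiv mul h1 h2 h3)

lemma titsHBasis_mul (c : G → G → G → ℂ)
    (hc : ∀ g h, mul (Finsupp.single g 1) (Finsupp.single h 1)
        = ∑ w : G, c g h w • Finsupp.single w 1) (g h : G) :
    titsHBasis mul h1 h2 h3 g * titsHBasis mul h1 h2 h3 h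
      = ∑ w, c g h w • titsHBasis mul h1 h2 h3 w := by
  simp only [titsHBasis, Basis.map_apply, Finsupp.coe_basisSingleOne]
  rw [← titsHEquiv_mul, hc, map_sum]
  simp only [map_smul]

end TitsAux2

lemma titsM_eval {G : Type*} [Fintype G] [DecidableEq G] {r : ℕ}
    (a : G → G → G → MvPolynomial (Fin r) ℂ) (q : Fin r → ℂ) :
    MvPolynomial.eval q (titsM a).det = (titsM fun g h w => MvPolynomial.eval q (a g h w)).det := by
  rw [RingHom.map_det]
  congr 1
  ext g h
  simp [titsM]

lemma tits_line_eval {r : ℕ} (P : MvPolynomial (Fin r) ℂ) (q0 q1 : Fin r → ℂ) (t : ℂ) :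
    Polynomial.eval t (MvPolynomial.aeval
      (fun i => Polynomial.C (q0 i) + Polynomial.X * Polynomial.C (q1 i - q0 i)) P)
      = MvPolynomial.eval (fun i => q0 i + t * (q1 i - q0 i)) P := by
  induction P using MvPolynomial.induction_on with
  | C a => simp
  | add p q hp hq => simp only [map_add, Polynomial.eval_add, hp, hq]
  | mul_X p i hp =>
    rw [map_mul, map_mul, Polynomial.eval_mul, hp, MvPolynomial.aeval_X, MvPolynomial.eval_X]
    simp only [Polynomial.eval_add, Polynomial.eval_mul, Polynomial.eval_C, Polynomial.eval_X]

/-- The line argument. -/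
lemma tits_line {r : ℕ} (P : MvPolynomial (Fin r) ℂ) (q0 q1 : Fin r → ℂ)
    (h0 : MvPolynomial.eval q0 P ≠ 0) :
    IsPreconnected {t : ℂ | MvPolynomial.eval (fun i => q0 i + t * (q1 i - q0 i)) P ≠ 0} := by
  let f : Polynomial ℂ := MvPolynomial.aeval
    (fun i => Polynomial.C (q0 i) + Polynomial.X * Polynomial.C (q1 i - q0 i)) P
  have hf : ∀ t, f.eval t = MvPolynomial.eval (fun i => q0 i + t * (q1 i - q0 i)) P := by
    intro t
    exact tits_line_eval P q0 q1 t
  have hne : f ≠ 0 := by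
    intro h
    apply h0
    have := hf 0
    simpa [h] using this.symm
  have hset : {t : ℂ | MvPolynomial.eval (fun i => q0 i + t * (q1 i - q0 i)) P ≠ 0}
      = {t : ℂ | f.IsRoot t}ᶜ := by
    ext t
    simp [← hf]
  rw [hset]
  exact ((Polynomial.finite_setOfPred_isRoot hne).countable.isPathConnected_compl_of_one_lt_rank
    (by simp)).isConnected.isPreconnected

theorem stmt_2 {G : Type*} [Group G] [Fintype G] (r : ℕ)
    (a : G → G → G → MvPolynomial (Fin r) ℂ)
    (mul : (Fin r → ℂ) → (G →₀ ℂ) →ₗ[ℂ] (G →₀ ℂ) →ₗ[ℂ] (G →₀ ℂ))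
    (hstruct : ∀ (q : Fin r → ℂ) (g h : G),
      mul q (Finsupp.single g 1) (Finsupp.single h 1)
        = ∑ w : G, MvPolynomial.eval q (a g h w) • Finsupp.single w 1)
    (hassoc : ∀ (q : Fin r → ℂ) (x y z : G →₀ ℂ), mul q (mul q x y) z = mul q x (mul q y z))
    (honel : ∀ (q : Fin r → ℂ) (x : G →₀ ℂ), mul q (Finsupp.single 1 1) x = x)
    (honer : ∀ (q : Fin r → ℂ) (x : G →₀ ℂ), mul q x (Finsupp.single 1 1) = x)
    (q0 : Fin r → ℂ)
    (hq0 : ∀ g h : G, MvPolynomial.eval q0 (a g h (g * h)) = 1)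
    (hq0' : ∀ g h w : G, w ≠ g * h → MvPolynomial.eval q0 (a g h w) = 0) :
    ∃ P : MvPolynomial (Fin r) ℂ, ∀ q : Fin r → ℂ,
      (MvPolynomial.eval q P ≠ 0 ↔
        @IsSemisimpleRing (G →₀ ℂ) (heckeRing (mul q) (hassoc q) (honel q) (honer q))) ∧
      (MvPolynomial.eval q P ≠ 0 ↔
        ∃ e : (G →₀ ℂ) ≃ₗ[ℂ] MonoidAlgebra ℂ G,
          (∀ x y : G →₀ ℂ, e (mul q x y) = e x * e y) ∧ e (Finsupp.single 1 1) = 1) := by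
  classical
  let c : (Fin r → ℂ) → G → G → G → ℂ := fun q g h w => MvPolynomial.eval q (a g h w)
  let H : (Fin r → ℂ) → Type _ := fun q => TitsH (mul q) (hassoc q) (honel q) (honer q)
  let L : ∀ q, (G →₀ ℂ) ≃ₗ[ℂ] TitsH (mul q) (hassoc q) (honel q) (honer q) :=
    fun q => titsHEquiv (mul q) (hassoc q) (honel q) (honer q)
  have hmul := fun q => titsHBasis_mul (mul q) (hassoc q) (honel q) (honer q) (c q) (hstruct q)
  have hP : ∀ q, MvPolynomial.eval q (titsM a).det = (titsM (c q)).det := titsM_eval a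
  have hss : ∀ q, MvPolynomial.eval q (titsM a).det ≠ 0 ↔
      IsSemisimpleRing (TitsH (mul q) (hassoc q) (honel q) (honer q)) := by
    intro q
    rw [hP]
    exact ⟨tits_semisimple_of_det _ _ (hmul q), fun _ => (tits_semisimple _ _ (hmul q)).1⟩
  have hiso : ∀ q, (∃ e : (G →₀ ℂ) ≃ₗ[ℂ] MonoidAlgebra ℂ G,
      (∀ x y : G →₀ ℂ, e (mul q x y) = e x * e y) ∧ e (Finsupp.single 1 1) = 1) ↔
      Nonempty (TitsH (mul q) (hassoc q) (honel q) (honer q) ≃ₐ[ℂ] MonoidAlgebra ℂ G) := by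
    intro q
    constructor
    · rintro ⟨e, he, he1⟩
      exact ⟨AlgEquiv.ofLinearEquiv ((L q).symm.trans e) he1 he⟩
    · rintro ⟨φ⟩
      refine ⟨(L q).trans φ.toLinearEquiv, fun x y => ?_, ?_⟩
      · exact map_mul φ (L q x) (L q y)
      · exact map_one φ
  have hiso_ss : ∀ q, Nonempty (TitsH (mul q) (hassoc q) (honel q) (honer q) ≃ₐ[ℂ]
      MonoidAlgebra ℂ G) → MvPolynomial.eval q (titsM a).det ≠ 0 := by
    rintro q ⟨φ⟩
    rw [hss]
    exact φ.symm.toRingEquiv.isSemisimpleRing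
  have h0 : Nonempty (TitsH (mul q0) (hassoc q0) (honel q0) (honer q0) ≃ₐ[ℂ]
      MonoidAlgebra ℂ G) := by
    rw [← hiso]
    refine ⟨(MonoidAlgebra.coeffLinearEquiv ℂ).symm, ?_, ?_⟩
    · have hs : ∀ g h : G, mul q0 (Finsupp.single g 1) (Finsupp.single h 1)
          = Finsupp.single (g * h) 1 := by
        intro g h
        rw [hstruct, Finset.sum_eq_single (g * h)]
        · rw [hq0, one_smul]
        · intro w _ hw
          rw [hq0' g h w hw, zero_smul]
        · simp
      intro x y
      have : (mul q0).compr₂ (MonoidAlgebra.coeffLinearEquiv ℂ).symm.toLinearMap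
          = (LinearMap.mul ℂ (MonoidAlgebra ℂ G)).compl₁₂
            (MonoidAlgebra.coeffLinearEquiv ℂ).symm.toLinearMap
            (MonoidAlgebra.coeffLinearEquiv ℂ).symm.toLinearMap := by
        apply Finsupp.basisSingleOne.ext
        intro g
        apply Finsupp.basisSingleOne.ext
        intro h
        simp [hs]
      exact LinearMap.congr_fun (LinearMap.congr_fun this x) y
    · rfl
  have hP0 := hiso_ss q0 h0
  refine ⟨(titsM a).det, fun q1 => ⟨hss q1, ?_⟩⟩
  rw [hiso]
  refine ⟨fun hP1 => ?_, hiso_ss q1⟩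
  have hdata : ∀ q, MvPolynomial.eval q (titsM a).det ≠ 0 → _ := fun q hq =>
    haveI := (hss q).1 hq
    (tits_semisimple _ _ (hmul q)).2
  obtain ⟨k, d, hd, hdN, hk, ⟨φ⟩, hF⟩ := hdata q0 hP0
  obtain ⟨k', d', hd', hdN', hk', ⟨φ'⟩, hF'⟩ := hdata q1 hP1
  have hcount : ∀ n, (Finset.univ.filter fun i => d' i = n).card
      = (Finset.univ.filter fun i => d i = n).card := by
    intro n
    rcases Nat.eq_zero_or_pos n with rfl | hn
    · simp [hd, hd']
    obtain ⟨p, hp⟩ := tits_indicator (Fintype.card G) n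
    let ℓ : ℂ → Fin r → ℂ := fun t i => q0 i + t * (q1 i - q0 i)
    have hℓ0 : ℓ 0 = q0 := by funext i; simp [ℓ]
    have hℓ1 : ℓ 1 = q1 := by funext i; simp [ℓ]
    have hconn : IsPreconnected {t : ℂ | MvPolynomial.eval (ℓ t) (titsM a).det ≠ 0} :=
      tits_line (titsM a).det q0 q1 hP0
    have hcont : ContinuousOn (fun t => titsF p (c (ℓ t)))
        {t : ℂ | MvPolynomial.eval (ℓ t) (titsM a).det ≠ 0} := by
      simp only [hP]
      refine tits_contOn (fun t => c (ℓ t)) (fun g h w => ?_) p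
      exact (MvPolynomial.continuous_eval (a g h w)).comp (by fun_prop)
    have hmaps : Set.MapsTo (fun t => titsF p (c (ℓ t)))
        {t : ℂ | MvPolynomial.eval (ℓ t) (titsM a).det ≠ 0}
        (Set.image (fun m : ℕ => (m : ℂ)) (Set.Iic (n ^ 2 * Fintype.card G))) := by
      intro t ht
      obtain ⟨k₂, d₂, hd₂, hdN₂, hk₂, -, hF₂⟩ := hdata (ℓ t) ht
      refine ⟨n ^ 2 * (Finset.univ.filter fun i => d₂ i = n).card, ?_, ?_⟩
      · refine Nat.mul_le_mul_left _ (le_trans (Finset.card_le_univ _) ?_)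
        simpa using hk₂
      · change _ = titsF p (c (ℓ t))
        rw [hF₂, tits_F_indicator d₂ _ n p hp hd₂ hdN₂]
    have heq := hconn.constant_of_mapsTo ((Set.finite_Iic _).image _).isDiscrete hcont hmaps
      (x := 1) (y := 0) (by change MvPolynomial.eval (ℓ 1) _ ≠ 0; rwa [hℓ1])
      (by change MvPolynomial.eval (ℓ 0) _ ≠ 0; rwa [hℓ0])
    simp only [hℓ0, hℓ1] at heq
    rw [hF, hF', tits_F_indicator d _ n p hp hd hdN, tits_F_indicator d' _ n p hp hd' hdN'] at heq
    exact Nat.eq_of_mul_eq_mul_left (pow_pos hn 2) (by exact_mod_cast heq)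
  obtain ⟨ψ⟩ := tits_equiv_of_count d' d hcount
  exact ⟨(φ'.trans ψ).trans (φ.symm.trans h0.some)⟩
end

section
/- (Explicit form of Theorem 2.4(a)) With a, b, t ∈ ℂˣ satisfying a² ≠ −1, b² ≠ −1 and a²b² ≠ 1, and with A_t, B ∈ M₂(ℂ) as defined in the context, the unital ℂ-subalgebra of M₂(ℂ) generated by A_t and B equals all of M₂(ℂ) (equivalently, A_t and B have no common eigenvector in ℂ²) if and only if t ∉ {ab, a⁻¹b⁻¹, −ab⁻¹, −a⁻¹b}. -/
/- STATEMENT 11: Explicit form of Theorem 2.4(a) for the affine Hecke algebra of type Ã₁.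
With `a, b, t ∈ ℂˣ` satisfying `a² ≠ -1`, `b² ≠ -1`, `a²b² ≠ 1`, the matrices
`A_t = [[t, (a²-1)t + a(b - b⁻¹)], [0, t⁻¹]]` and `B = [[0, a²], [1, a²-1]]`
generate all of `M₂(ℂ)` as a unital ℂ-subalgebra (i.e. the two-dimensional induced module
`ind_{ℂ[X]}^{ℋ}(ℂ_t)` is irreducible) if and only if
`t ∉ {ab, a⁻¹b⁻¹, -ab⁻¹, -a⁻¹b}`. -/

open Matrix

/-- The matrix of the action of `θ₁` on `ind_{ℂ[X]}^{ℋ}(ℂ_t)` in the basis `(v, T_{s_α} v)`. -/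
noncomputable def heckeThetaMat (a b t : ℂ) : Matrix (Fin 2) (Fin 2) ℂ :=
  !![t, (a ^ 2 - 1) * t + a * (b - b⁻¹); 0, t⁻¹]

/-- The matrix of the action of `T_{s_α}` on `ind_{ℂ[X]}^{ℋ}(ℂ_t)` in the basis
`(v, T_{s_α} v)`. -/
noncomputable def heckeTMat (a : ℂ) : Matrix (Fin 2) (Fin 2) ℂ :=
  !![0, a ^ 2; 1, a ^ 2 - 1]

theorem hecke_aux_inv (x : ℂ) (A B : Matrix (Fin 2) (Fin 2) ℂ)
    (hA : x * A 0 0 + A 0 1 = x * (x * A 1 0 + A 1 1))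
    (hB : x * B 0 0 + B 0 1 = x * (x * B 1 0 + B 1 1)) :
    Algebra.adjoin ℂ {A, B} ≠ (⊤ : Subalgebra ℂ (Matrix (Fin 2) (Fin 2) ℂ)) := by
  intro h
  have key : ∀ M ∈ Algebra.adjoin ℂ {A, B},
      x * M 0 0 + M 0 1 = x * (x * M 1 0 + M 1 1) := by
    intro M hM
    induction hM using Algebra.adjoin_induction with
    | mem M hM =>
      rcases hM with rfl | rfl
      · exact hA
      · exact hB
    | algebraMap r => simp [Matrix.algebraMap_matrix_apply]
    | add M N _ _ hM hN =>
      simp only [Matrix.add_apply]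
      linear_combination hM + hN
    | mul M N _ _ hM hN =>
      simp only [Matrix.mul_apply, Fin.sum_univ_two]
      linear_combination (x * N 1 0 + N 1 1) * hM + (M 0 0 - x * M 1 0) * hN
  have := key !![0, 1; 0, 0] (h ▸ Algebra.mem_top)
  simp at this

theorem hecke_aux_gen (q t c s : ℂ) (h1 : q * (t - s) - c ≠ 0) (h2 : t - s + c ≠ 0) :
    Algebra.adjoin ℂ {!![t, c; 0, s], !![0, q; 1, q - 1]}
      = (⊤ : Subalgebra ℂ (Matrix (Fin 2) (Fin 2) ℂ)) := by
  set S := Algebra.adjoin ℂ ({!![t, c; 0, s], !![0, q; 1, q - 1]} :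
    Set (Matrix (Fin 2) (Fin 2) ℂ)) with hS
  have hA : !![t, c; 0, s] ∈ S := Algebra.subset_adjoin (by simp)
  have hB : !![0, q; 1, q - 1] ∈ S := Algebra.subset_adjoin (by simp)
  have hE : !![t - s, c; 0, 0] ∈ S := by
    have := S.sub_mem hA (S.smul_mem S.one_mem s)
    convert this using 1
    ext i j; fin_cases i <;> fin_cases j <;> simp
  have hEB := S.mul_mem hE hB
  obtain ⟨D, hD⟩ : ∃ D, D * ((q * (t - s) - c) * (t - s + c)) = 1 :=
    ⟨_, inv_mul_cancel₀ (mul_ne_zero h1 h2)⟩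
  have h11 : !![1, 0; 0, 0] ∈ S := by
    have := S.sub_mem (S.smul_mem hE (D * ((t - s) * q + c * (q - 1)))) (S.smul_mem hEB (D * c))
    convert this using 1
    ext i j; fin_cases i <;> fin_cases j <;> simp
    · linear_combination -hD
    · ring
  have h12 : !![0, 1; 0, 0] ∈ S := by
    have := S.sub_mem (S.smul_mem hEB (D * (t - s))) (S.smul_mem hE (D * c))
    convert this using 1
    ext i j; fin_cases i <;> fin_cases j <;> simp
    · ring
    · linear_combination -hD
  have h21 := S.mul_mem hB h11
  have h22 := S.mul_mem hB h12
  rw [eq_top_iff]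
  intro M _
  have := S.add_mem (S.add_mem (S.smul_mem h11 (M 0 0)) (S.smul_mem h12 (M 0 1)))
    (S.add_mem (S.smul_mem h21 (M 1 0)) (S.smul_mem h22 (M 1 1)))
  convert this using 1
  ext i j; fin_cases i <;> fin_cases j <;> simp

theorem stmt_11 (a b t : ℂ) (ha : a ≠ 0) (hb : b ≠ 0) (ht : t ≠ 0)
    (ha2 : a ^ 2 ≠ -1) (hb2 : b ^ 2 ≠ -1) (hab : a ^ 2 * b ^ 2 ≠ 1) :
    Algebra.adjoin ℂ {heckeThetaMat a b t, heckeTMat a}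
        = (⊤ : Subalgebra ℂ (Matrix (Fin 2) (Fin 2) ℂ)) ↔
      t ∉ ({a * b, a⁻¹ * b⁻¹, -(a * b⁻¹), -(a⁻¹ * b)} : Set ℂ) := by
  simp only [Set.mem_insert_iff, Set.mem_singleton_iff]
  constructor
  · rintro h (hx | hx | hx | hx)
    · refine hecke_aux_inv (-a ^ 2) _ _ ?_ ?_ h
      · simp [heckeThetaMat, hx]; field_simp; ring
      · simp [heckeTMat]; ring
    · refine hecke_aux_inv 1 _ _ ?_ ?_ h
      · simp [heckeThetaMat, hx]; field_simp; ring
      · simp [heckeTMat]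
    · refine hecke_aux_inv (-a ^ 2) _ _ ?_ ?_ h
      · simp [heckeThetaMat, hx]; field_simp; ring
      · simp [heckeTMat]; ring
    · refine hecke_aux_inv 1 _ _ ?_ ?_ h
      · simp [heckeThetaMat, hx]; field_simp; ring
      · simp [heckeTMat]
  · intro h
    push Not at h
    obtain ⟨n1, n2, n3, n4⟩ := h
    refine hecke_aux_gen (a ^ 2) t _ t⁻¹ ?_ ?_
    · have e : a ^ 2 * (t - t⁻¹) - ((a ^ 2 - 1) * t + a * (b - b⁻¹))
          = t⁻¹ * ((t - a * b) * (t - -(a * b⁻¹))) := by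
        field_simp; ring
      rw [e]
      exact mul_ne_zero (inv_ne_zero ht) (mul_ne_zero (sub_ne_zero.2 n1) (sub_ne_zero.2 n3))
    · have e : t - t⁻¹ + ((a ^ 2 - 1) * t + a * (b - b⁻¹))
          = a ^ 2 * t⁻¹ * ((t - a⁻¹ * b⁻¹) * (t - -(a⁻¹ * b))) := by
        field_simp; ring
      rw [e]
      exact mul_ne_zero (mul_ne_zero (pow_ne_zero 2 ha) (inv_ne_zero ht))
        (mul_ne_zero (sub_ne_zero.2 n2) (sub_ne_zero.2 n4))
end

section
/- (Explicit form of Theorem 2.4(b)) With a, b ∈ ℂˣ satisfying a² ≠ −1, b² ≠ −1 and a²b² ≠ 1, and with A_t, B ∈ M₂(ℂ) as defined in the context: for every t ∈ ℂˣ with t ∉ {ab, a⁻¹b⁻¹, −ab⁻¹, −a⁻¹b} there exists P ∈ GL₂(ℂ) such that P A_t P⁻¹ = A_{t⁻¹} and P B P⁻¹ = B; that is, the two-dimensional representations determined by the pairs (A_t, B) and (A_{t⁻¹}, B) are equivalent. -/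
/- STATEMENT 12: Explicit form of Theorem 2.4(b) for the affine Hecke algebra of type Ã₁.
For `t` outside the four special values, the two-dimensional representations determined by
the pairs `(A_t, B)` and `(A_{t⁻¹}, B)` are equivalent: there is `P ∈ GL₂(ℂ)` with
`P A_t P⁻¹ = A_{t⁻¹}` and `P B P⁻¹ = B`. -/

open Matrix

theorem stmt_12 (a b : ℂ) (ha : a ≠ 0) (hb : b ≠ 0)
    (ha2 : a ^ 2 ≠ -1) (hb2 : b ^ 2 ≠ -1) (hab : a ^ 2 * b ^ 2 ≠ 1)
    (t : ℂ) (ht : t ≠ 0)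
    (htne : t ∉ ({a * b, a⁻¹ * b⁻¹, -(a * b⁻¹), -(a⁻¹ * b)} : Set ℂ)) :
    ∃ P : (Matrix (Fin 2) (Fin 2) ℂ)ˣ,
      (P : Matrix (Fin 2) (Fin 2) ℂ) * heckeThetaMat a b t * ((P⁻¹ : _ˣ) : Matrix (Fin 2) (Fin 2) ℂ)
          = heckeThetaMat a b t⁻¹ ∧
      (P : Matrix (Fin 2) (Fin 2) ℂ) * heckeTMat a * ((P⁻¹ : _ˣ) : Matrix (Fin 2) (Fin 2) ℂ)
          = heckeTMat a := by
  simp only [Set.mem_insert_iff, Set.mem_singleton_iff, not_or] at htne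
  obtain ⟨h1, h2, h3, h4⟩ := htne
  -- the intertwiner `x + y B`, with `x = c_{t⁻¹}` and `y = t - t⁻¹`
  let M : Matrix (Fin 2) (Fin 2) ℂ :=
    !![(a ^ 2 - 1) * t⁻¹ + a * (b - b⁻¹), (t - t⁻¹) * a ^ 2;
       t - t⁻¹, (a ^ 2 - 1) * t⁻¹ + a * (b - b⁻¹) + (t - t⁻¹) * (a ^ 2 - 1)]
  have hdet : M.det = -(a ^ 2 * t⁻¹ ^ 2 * ((t - a * b) * (t - a⁻¹ * b⁻¹) *
      (t - -(a * b⁻¹)) * (t - -(a⁻¹ * b)))) := by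
    simp only [M, Matrix.det_fin_two_of]
    field_simp
    ring
  have hne : M.det ≠ 0 := by
    rw [hdet]
    refine neg_ne_zero.2 (mul_ne_zero (mul_ne_zero (pow_ne_zero _ ha)
      (pow_ne_zero _ (inv_ne_zero ht))) ?_)
    exact mul_ne_zero (mul_ne_zero (mul_ne_zero (sub_ne_zero.2 h1) (sub_ne_zero.2 h2))
      (sub_ne_zero.2 h3)) (sub_ne_zero.2 h4)
  obtain ⟨P, hP⟩ := (Matrix.isUnit_iff_isUnit_det M).2 (isUnit_iff_ne_zero.2 hne)
  refine ⟨P, ?_, ?_⟩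
  · rw [Units.mul_inv_eq_iff_eq_mul, hP]
    simp only [M, heckeThetaMat, inv_inv]
    ext i j
    fin_cases i <;> fin_cases j <;> simp [Matrix.mul_apply, Fin.sum_univ_two] <;> ring
  · rw [Units.mul_inv_eq_iff_eq_mul, hP]
    simp only [M, heckeTMat]
    ext i j
    fin_cases i <;> fin_cases j <;> simp [Matrix.mul_apply, Fin.sum_univ_two] <;> ring
end

section
/- (Triviality of the Clifford 2-cocycle for diagram automorphisms, used in the proof of Lemma 6.6) Let W be a finite Weyl group with set S of simple reflections and let Γ be a finite group acting on W by group automorphisms that map S to S. Then for every irreducible complex representation (π,V) of W there exists a group homomorphism I : Γ_π → GL(V) such that I(γ) π(w) I(γ)⁻¹ = π(γ(w)) for all γ ∈ Γ_π and all w ∈ W. -/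
/- STATEMENT 14 (Triviality of the Clifford 2-cocycle for diagram automorphisms): Let `W`
be a finite Weyl group with set `S` of simple reflections (a finite crystallographic
Coxeter system: all off-diagonal Coxeter matrix entries lie in `{2, 3, 4, 6}`), and let
`Γ` be a finite group acting on `W` by automorphisms mapping `S` to `S`.  Then for every
irreducible complex representation `(π, V)` of `W` there exists a group homomorphism
`I : Γ_π →* GL(V)` with `I(γ) π(w) I(γ)⁻¹ = π(γ(w))` for all `γ ∈ Γ_π`, `w ∈ W`, where
`Γ_π = {γ ∈ Γ : γ*(π) ≅ π}` is the isotropy group of the isomorphism class of `π`. -/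

/-- The representation `π` of `W` on `V` is irreducible. -/
def IsIrreducibleRep {W V : Type*} [Group W] [AddCommGroup V] [Module ℂ V]
    (π : W →* (V →ₗ[ℂ] V)) : Prop :=
  (∃ v : V, v ≠ 0) ∧
  ∀ U : Submodule ℂ V, (∀ (w : W), ∀ v ∈ U, π w v ∈ U) → U = ⊥ ∨ U = ⊤

/-- The isotropy group `Γ_π ≤ Γ` of the isomorphism class of the representation `π` under
the action of `Γ`; `γ ∈ Γ_π` iff `γ*(π) ≅ π`, i.e. iff there is a linear automorphism `e`
of `V` with `e ∘ π(w) = π(γ(w)) ∘ e` for all `w`. -/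
def isotropyGroup {W Γ V : Type*} [Group W] [Group Γ] (act : Γ →* MulAut W)
    [AddCommGroup V] [Module ℂ V] (π : W →* (V →ₗ[ℂ] V)) : Subgroup Γ where
  carrier := {γ | ∃ e : V ≃ₗ[ℂ] V, ∀ (w : W) (v : V), e (π w v) = π (act γ w) (e v)}
  one_mem' := ⟨LinearEquiv.refl ℂ V, fun w v => by simp⟩
  mul_mem' := by
    rintro γ δ ⟨e, he⟩ ⟨f, hf⟩
    refine ⟨f.trans e, fun w v => ?_⟩
    have : act (γ * δ) w = act γ (act δ w) := by rw [map_mul]; rfl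
    simp only [LinearEquiv.trans_apply, hf, he, this]
  inv_mem' := by
    rintro γ ⟨e, he⟩
    refine ⟨e.symm, fun w v => ?_⟩
    apply e.injective
    rw [he (act γ⁻¹ w) (e.symm v), LinearEquiv.apply_symm_apply, ← MulAut.mul_apply,
      ← map_mul, mul_inv_cancel, map_one, MulAut.one_apply, LinearEquiv.apply_symm_apply]


noncomputable section CoxPart

/-- The symmetric (real) Cartan matrix of a crystallographic Coxeter matrix. -/
def cartanA {B : Type*} (M : CoxeterMatrix B) (i j : B) : ℝ :=
  open Classical in
  if i = j then 2 else if M i j = 2 then 0 else if M i j = 3 then -1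
    else if M i j = 4 then -√2 else -√3

lemma cartanA_symm {B : Type*} (M : CoxeterMatrix B) (i j : B) :
    cartanA M i j = cartanA M j i := by
  unfold cartanA
  rw [M.symmetric i j]
  by_cases h : i = j
  · simp [h]
  · have h' : ¬ j = i := fun h' => h h'.symm
    simp [h, h']

lemma cartanA_self {B : Type*} (M : CoxeterMatrix B) (i : B) : cartanA M i i = 2 := by
  simp [cartanA]

lemma cartanA_nonpos {B : Type*} (M : CoxeterMatrix B) {i j : B} (h : i ≠ j) :
    cartanA M i j ≤ 0 := by
  simp only [cartanA, h, if_false]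
  split_ifs
  · exact le_rfl
  · norm_num
  · simp
  · simp

lemma cartanA_le {B : Type*} (M : CoxeterMatrix B) {i j : B} (h : i ≠ j) (h2 : M i j ≠ 2) :
    cartanA M i j ≤ -1 := by
  simp only [cartanA, h, h2, if_false]
  split_ifs
  · exact le_rfl
  · have : (1:ℝ) ≤ √2 := by rw [Real.one_le_sqrt]; norm_num
    linarith
  · have : (1:ℝ) ≤ √3 := by rw [Real.one_le_sqrt]; norm_num
    linarith

/-- The coordinate functional. -/
def cartanF {B : Type*} (M : CoxeterMatrix B) (i : B) : (B →₀ ℝ) →ₗ[ℝ] ℝ :=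
  Finsupp.linearCombination ℝ (fun j => cartanA M i j)

/-- The geometric reflection. -/
def geomRefl {B : Type*} (M : CoxeterMatrix B) (i : B) : Module.End ℝ (B →₀ ℝ) :=
  LinearMap.id - (cartanF M i).smulRight (Finsupp.single i 1)

lemma cartanF_single {B : Type*} (M : CoxeterMatrix B) (i j : B) :
    cartanF M i (Finsupp.single j 1) = cartanA M i j := by
  simp [cartanF]

lemma geomRefl_apply {B : Type*} (M : CoxeterMatrix B) (i : B) (x : B →₀ ℝ) :
    geomRefl M i x = x - cartanF M i x • Finsupp.single i 1 := by
  simp [geomRefl]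

/-- Abstract two-reflection computation. -/
lemma two_refl_pow {E : Type*} [AddCommGroup E] [Module ℝ E] (f g : E →ₗ[ℝ] ℝ) (u v : E) (a : ℝ)
    (hfu : f u = 2) (hgv : g v = 2) (hfv : f v = a) (hgu : g u = a)
    (S T : Module.End ℝ E) (hS : ∀ x, S x = x - f x • u) (hT : ∀ x, T x = x - g x • v) :
    (a = 0 → (S * T) ^ 2 = 1) ∧ (a = -1 → (S * T) ^ 3 = 1) ∧
    (a ^ 2 = 2 → (S * T) ^ 4 = 1) ∧ (a ^ 2 = 3 → (S * T) ^ 6 = 1) := by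
  have key : ∀ (x : E) (c d : ℝ), (S * T) (x + c • u + d • v) =
      x + (-f x - c + a * g x + a ^ 2 * c + a * d) • u + (- g x - a * c - d) • v := by
    intro x c d
    rw [Module.End.mul_apply, hT, hS]
    simp only [map_add, map_sub, map_smul, hfu, hgv, hfv, hgu, smul_eq_mul]
    module
  have k1 : ∀ x, (S * T) x = x + (-f x + a * g x) • u + (- g x) • v := by
    intro x
    have := key x 0 0
    simpa using this
  refine ⟨?_, ?_, ?_, ?_⟩
  all_goals intro ha; ext x
  · subst ha
    simp only [pow_succ, pow_zero, one_mul, Module.End.mul_apply (S * T), k1 x, key, Module.End.one_apply]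
    module
  · subst ha
    simp only [pow_succ, pow_zero, one_mul, Module.End.mul_apply (S * T), Module.End.mul_apply (_ * (S * T)), k1 x, key, Module.End.one_apply]
    module
  · have a3 : a ^ 3 = 2 * a := by rw [pow_succ, ha]
    have a4 : a ^ 4 = 4 := by rw [show a ^ 4 = (a ^ 2) ^ 2 by ring, ha]; norm_num
    simp only [pow_succ, pow_zero, one_mul, Module.End.mul_apply _ (S * T), k1 x, key, Module.End.one_apply]
    match_scalars
    · ring
    · simp only [mul_one]; ring_nf; grind
    · simp only [mul_one]; ring_nf; grind
  · simp only [pow_succ, pow_zero, one_mul, Module.End.mul_apply _ (S * T), k1 x, key, Module.End.one_apply]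
    match_scalars
    · ring
    · simp only [mul_one]; ring_nf; grind
    · simp only [mul_one]; ring_nf; grind

lemma geomRefl_liftable {B : Type*} (M : CoxeterMatrix B)
    (hcrys : ∀ i j : B, i ≠ j → M i j ∈ ({2, 3, 4, 6} : Set ℕ)) :
    M.IsLiftable (geomRefl M) := by
  intro i j
  by_cases hij : i = j
  · subst hij
    rw [M.diagonal, pow_one]
    refine LinearMap.ext fun x => ?_
    simp only [Module.End.mul_apply, geomRefl_apply, map_sub, map_smul, cartanF_single,
      cartanA_self, Module.End.one_apply, smul_eq_mul]
    module
  · have := two_refl_pow (cartanF M i) (cartanF M j) (Finsupp.single i 1) (Finsupp.single j 1)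
      (cartanA M i j) (by rw [cartanF_single, cartanA_self]) (by rw [cartanF_single, cartanA_self])
      (cartanF_single M i j) (by rw [cartanF_single, cartanA_symm])
      (geomRefl M i) (geomRefl M j) (geomRefl_apply M i) (geomRefl_apply M j)
    obtain ⟨h2, h3, h4, h6⟩ := this
    have hm := hcrys i j hij
    simp only [Set.mem_insert_iff, Set.mem_singleton_iff] at hm
    rcases hm with h | h | h | h
    · rw [h]; exact h2 (by simp [cartanA, hij, h])
    · rw [h]; exact h3 (by simp [cartanA, hij, h])
    · rw [h]; exact h4 (by simp [cartanA, hij, h])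
    · rw [h]; exact h6 (by simp [cartanA, hij, h])

lemma cox_simple_injective {B W : Type*} [Group W] {M : CoxeterMatrix B}
    (cs : CoxeterSystem M W)
    (hcrys : ∀ i j : B, i ≠ j → M i j ∈ ({2, 3, 4, 6} : Set ℕ)) :
    Function.Injective cs.simple := by
  intro i j h
  by_contra hij
  have hl := geomRefl_liftable M hcrys
  have e : geomRefl M i = geomRefl M j := by
    rw [← cs.lift_apply_simple hl i, ← cs.lift_apply_simple hl j, h]
  have e2 := congrArg (fun f => (f (Finsupp.single i 1)) i) e
  simp [geomRefl_apply, cartanF_single, cartanA_self, hij] at e2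

/-- The positivity property of finite type diagrams. -/
def FinType {C : Type*} [Fintype C] (G : SimpleGraph C) : Prop :=
  open Classical in
  ∀ x : C → ℝ, (∀ i, 0 ≤ x i) →
    (∀ i, 0 < x i → 2 * x i ≤ ∑ k, if G.Adj i k then x k else 0) → ∀ i, x i = 0

/-- Noncommuting graph of simple reflections. -/
def coxGraph {B W : Type*} [Group W] {M : CoxeterMatrix B} (cs : CoxeterSystem M W) :
    SimpleGraph B where
  Adj i j := ¬ Commute (cs.simple i) (cs.simple j)
  symm := ⟨fun _ _ h h' => h h'.symm⟩
  loopless := ⟨fun _ h => h (Commute.refl _)⟩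

lemma coxGraph_finType {B W : Type*} [Group W] [Fintype W] [Fintype B] {M : CoxeterMatrix B}
    (cs : CoxeterSystem M W)
    (hcrys : ∀ i j : B, i ≠ j → M i j ∈ ({2, 3, 4, 6} : Set ℕ)) :
    FinType (coxGraph cs) := by
  classical
  intro x hx hsub
  have hl := geomRefl_liftable M hcrys
  set R : W →* Module.End ℝ (B →₀ ℝ) := cs.lift ⟨geomRefl M, hl⟩ with hR
  have hRs : ∀ i, R (cs.simple i) = geomRefl M i := fun i => cs.lift_apply_simple hl i
  let Q : (B →₀ ℝ) → (B →₀ ℝ) → ℝ := fun y z => ∑ w : W, ∑ b : B, R w y b * R w z b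
  have Qinv : ∀ (w₀ : W) y z, Q (R w₀ y) (R w₀ z) = Q y z := by
    intro w₀ y z
    refine Fintype.sum_equiv (Equiv.mulRight w₀) _ _ (fun w => ?_)
    simp [map_mul]
  have Qadd : ∀ y y' z, Q (y + y') z = Q y z + Q y' z := by
    intro y y' z
    simp [Q, add_mul, Finset.sum_add_distrib]
  have Qsmul : ∀ (c : ℝ) y z, Q (c • y) z = c * Q y z := by
    intro c y z
    simp [Q, Finset.mul_sum, mul_assoc]
  have Qsymm : ∀ y z, Q y z = Q z y := by
    intro y z
    simp only [Q, mul_comm]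
  have Qpos : ∀ y, 0 ≤ Q y y := fun y =>
    Finset.sum_nonneg fun w _ => Finset.sum_nonneg fun b _ => mul_self_nonneg _
  have Qdef : ∀ y, Q y y ≤ 0 → y = 0 := by
    intro y h
    have h0 : Q y y = 0 := le_antisymm h (Qpos y)
    rw [Finset.sum_eq_zero_iff_of_nonneg
      (fun w _ => Finset.sum_nonneg fun b _ => mul_self_nonneg _)] at h0
    have h1 := h0 1 (Finset.mem_univ _)
    rw [Finset.sum_eq_zero_iff_of_nonneg (fun b _ => mul_self_nonneg _)] at h1
    ext b
    simpa using h1 b (Finset.mem_univ _)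
  have Qrefl : ∀ y i, 2 * Q y (Finsupp.single i 1) =
      cartanF M i y * Q (Finsupp.single i 1) (Finsupp.single i 1) := by
    intro y i
    have h := Qinv (cs.simple i) y (Finsupp.single i 1)
    rw [hRs, geomRefl_apply, geomRefl_apply, cartanF_single, cartanA_self] at h
    have e1 : (Finsupp.single i 1 - (2:ℝ) • Finsupp.single i 1 : B →₀ ℝ)
      = (-1 : ℝ) • Finsupp.single i 1 := by module
    have e2 : y - cartanF M i y • Finsupp.single i 1 =
      y + (-cartanF M i y) • Finsupp.single i 1 := by module
    rw [e1, e2, Qsymm, Qsmul, Qsymm, Qadd, Qsmul] at h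
    linarith
  let X : B →₀ ℝ := Finsupp.equivFunOnFinite.symm x
  have hX : X = ∑ i, x i • Finsupp.single i (1:ℝ) := by
    ext b
    simp [X, Finsupp.single_apply]
  have Qsum : ∀ z, Q X z = ∑ i, x i * Q (Finsupp.single i 1) z := by
    intro z
    rw [hX]
    have : ∀ s : Finset B, Q (∑ i ∈ s, x i • Finsupp.single i (1:ℝ)) z =
        ∑ i ∈ s, x i * Q (Finsupp.single i 1) z := by
      intro s
      induction s using Finset.induction_on with
      | empty => simp [Q]
      | insert a s ha ih => rw [Finset.sum_insert ha, Finset.sum_insert ha, Qadd, Qsmul, ih]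
    exact this _
  have hF : ∀ i, 0 < x i → cartanF M i X ≤ 0 := by
    intro i hi
    have e : cartanF M i X = ∑ k, x k * cartanA M i k := by
      simp only [hX, map_sum, map_smul, cartanF_single, smul_eq_mul]
    have h2 := hsub i hi
    have : ∑ k, x k * cartanA M i k ≤
        ∑ k, ((if k = i then 2 * x i else 0) - (if (coxGraph cs).Adj i k then x k else 0)) := by
      refine Finset.sum_le_sum fun k _ => ?_
      by_cases hk : k = i
      · subst hk
        simp [cartanA_self, mul_comm]
      · rw [if_neg hk]
        split_ifs with hadj
        · have : M i k ≠ 2 := by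
            intro h2
            apply hadj
            have h3 := cs.simple_mul_simple_pow i k
            rw [h2, pow_two] at h3
            have h4 := mul_eq_one_iff_eq_inv.mp h3
            rw [mul_inv_rev, cs.inv_simple, cs.inv_simple] at h4
            exact h4
          have := cartanA_le M (Ne.symm hk) this
          nlinarith [hx k]
        · have := cartanA_nonpos M (Ne.symm hk)
          nlinarith [hx k]
    rw [Finset.sum_sub_distrib] at this
    simp only [Finset.sum_ite_eq', Finset.mem_univ, if_true] at this
    rw [e]
    linarith
  have hQX : Q X X ≤ 0 := by
    rw [Qsum]
    refine Finset.sum_nonpos fun i _ => ?_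
    rcases (hx i).eq_or_lt with h | h
    · simp [← h]
    · have h1 := Qrefl X i
      have h2 := hF i h
      have h3 := Qpos (Finsupp.single i 1)
      rw [Qsymm]
      have : Q X (Finsupp.single i 1) ≤ 0 := by nlinarith
      nlinarith
  have hX0 := Qdef X hQX
  intro i
  have := DFunLike.congr_fun hX0 i
  simpa [X] using this

end CoxPart

section GraphPart

open Classical in
lemma FinType.absurd_of {C : Type*} [Fintype C] {G : SimpleGraph C} (h : FinType G)
    (x : C → ℝ) (hx : ∀ i, 0 ≤ x i) (i₀ : C) (hi₀ : 0 < x i₀)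
    (hs : ∀ i, 0 < x i → ∃ s : Finset C, (∀ k ∈ s, G.Adj i k) ∧ 2 * x i ≤ ∑ k ∈ s, x k) :
    False := by
  have := h x hx ?_ i₀
  · linarith
  · intro i hi
    obtain ⟨s, hs1, hs2⟩ := hs i hi
    refine hs2.trans ?_
    rw [← Finset.sum_filter]
    refine Finset.sum_le_sum_of_subset_of_nonneg ?_ (fun k _ _ => hx k)
    intro k hk
    simp [hs1 k hk]

open Classical in
lemma FinType.no_triangle {C : Type*} [Fintype C] {G : SimpleGraph C} (h : FinType G)
    {i j k : C} (hij : G.Adj i j) (hjk : G.Adj j k) (hki : G.Adj k i) : False := by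
  refine h.absurd_of (fun v => if v = i ∨ v = j ∨ v = k then 1 else 0)
    (fun v => by positivity) i (by simp) ?_
  intro v hv
  have hv' : v = i ∨ v = j ∨ v = k := by
    by_contra hc
    simp [hc] at hv
  rcases hv' with rfl | rfl | rfl
  · refine ⟨{j, k}, by simp [hij, hki.symm], ?_⟩
    rw [Finset.sum_pair hjk.ne]; norm_num
  · refine ⟨{i, k}, by simp [hjk, hij.symm], ?_⟩
    rw [Finset.sum_pair hki.ne.symm]; norm_num
  · refine ⟨{i, j}, by simp [hjk.symm, hki], ?_⟩
    rw [Finset.sum_pair hij.ne]; norm_num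

open Classical in
lemma FinType.degree_le {C : Type*} [Fintype C] {G : SimpleGraph C} (h : FinType G)
    (b : C) : G.degree b ≤ 3 := by
  by_contra hb
  push Not at hb
  refine h.absurd_of (fun v => if v = b then 2 else if G.Adj b v then 1 else 0)
    (fun v => by positivity) b (by simp) ?_
  intro v hv
  by_cases hvb : v = b
  · subst hvb
    refine ⟨G.neighborFinset v, by simp, ?_⟩
    rw [Finset.sum_congr rfl (g := fun _ => (1:ℝ))]
    · simp only [if_true, Finset.sum_const, SimpleGraph.card_neighborFinset_eq_degree, nsmul_eq_mul,
        mul_one]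
      have : (4:ℝ) ≤ G.degree v := by exact_mod_cast hb
      linarith
    · intro k hk
      rw [SimpleGraph.mem_neighborFinset] at hk
      simp [hk, hk.ne.symm]
  · have hadj : G.Adj b v := by
      by_contra hc
      simp [hc, hvb] at hv
    refine ⟨{b}, by simp [hadj.symm], ?_⟩
    simp [hvb, hadj]

open Classical in
lemma FinType.branch_unique {C : Type*} [Fintype C] {G : SimpleGraph C} (h : FinType G)
    (hconn : G.Connected) {b b' : C} (hb : 3 ≤ G.degree b) (hb' : 3 ≤ G.degree b') : b = b' := by
  by_contra hne
  obtain ⟨p, hp⟩ := (hconn.preconnected b b').exists_isPath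
  have hlen : 0 < p.length := by
    rw [Nat.pos_iff_ne_zero]
    intro h0
    exact hne (SimpleGraph.Walk.eq_of_length_eq_zero h0)
  set x : C → ℝ := fun v => if v ∈ p.support then 2 else if G.Adj b v ∨ G.Adj b' v then 1 else 0
    with hxdef
  have hx0 : ∀ i, 0 ≤ x i := fun v => by simp only [hxdef]; positivity
  have hx2 : ∀ i, x (p.getVert i) = 2 := fun i => by
    simp [hxdef, SimpleGraph.Walk.getVert_mem_support]
  -- at a branch vertex
  have hend : ∀ (c q : C), (c = b ∨ c = b') → 3 ≤ G.degree c → G.Adj c q → x q = 2 →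
      ∃ s : Finset C, (∀ k ∈ s, G.Adj c k) ∧ (4:ℝ) ≤ ∑ k ∈ s, x k := by
    intro c q hc hdeg hadj hq
    refine ⟨G.neighborFinset c, by simp, ?_⟩
    have hqm : q ∈ G.neighborFinset c := by simpa using hadj
    rw [← Finset.add_sum_erase _ _ hqm, hq]
    have hge : ∀ k ∈ (G.neighborFinset c).erase q, (1:ℝ) ≤ x k := by
      intro k hk
      have hk' : G.Adj c k := by
        simpa using (Finset.mem_of_mem_erase hk)
      simp only [hxdef]
      split_ifs with h1 h2
      · norm_num
      · exact le_rfl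
      · exact absurd (by rcases hc with rfl | rfl <;> simp [hk']) h2
    have hcard := Finset.card_nsmul_le_sum _ _ _ hge
    rw [Finset.card_erase_of_mem hqm, SimpleGraph.card_neighborFinset_eq_degree] at hcard
    have : (2:ℝ) ≤ ((G.degree c - 1 : ℕ) : ℝ) := by
      have : 2 ≤ G.degree c - 1 := by omega
      exact_mod_cast this
    simp only [nsmul_eq_mul, mul_one] at hcard
    linarith
  refine h.absurd_of x hx0 b (by simp [hxdef]) ?_
  intro v hv
  by_cases hvp : v ∈ p.support
  · have hxv : x v = 2 := by simp [hxdef, hvp]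
    rw [hxv]
    obtain ⟨n, hn, hnl⟩ := SimpleGraph.Walk.mem_support_iff_exists_getVert.mp hvp
    norm_num
    by_cases hn0 : n = 0
    · subst hn0
      rw [SimpleGraph.Walk.getVert_zero] at hn
      subst hn
      have := p.adj_getVert_succ hlen
      rw [SimpleGraph.Walk.getVert_zero] at this
      exact hend _ _ (Or.inl rfl) hb this (hx2 _)
    by_cases hnl' : n = p.length
    · subst hnl'
      rw [SimpleGraph.Walk.getVert_length] at hn
      subst hn
      have := p.adj_getVert_succ (i := p.length - 1) (by omega)
      rw [Nat.sub_add_cancel hlen, SimpleGraph.Walk.getVert_length] at this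
      exact hend _ _ (Or.inr rfl) hb' this.symm (hx2 _)
    have h1 := p.adj_getVert_succ (i := n - 1) (by omega)
    have h2 := p.adj_getVert_succ (i := n) (by omega)
    rw [Nat.sub_add_cancel (by omega), hn] at h1
    rw [hn] at h2
    have hneq : p.getVert (n - 1) ≠ p.getVert (n + 1) := by
      intro he
      have := hp.getVert_injOn (by simp; omega) (by simp; omega) he
      omega
    refine ⟨{p.getVert (n - 1), p.getVert (n + 1)}, by simp [h1.symm, h2], ?_⟩
    rw [Finset.sum_pair hneq, hx2, hx2]
    norm_num
  · have hadj : G.Adj b v ∨ G.Adj b' v := by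
      by_contra hc
      simp [hxdef, hvp, hc] at hv
    have hxv : x v = 1 := by simp [hxdef, hvp, hadj]
    rw [hxv]
    rcases hadj with hadj | hadj
    · refine ⟨{b}, by simp [hadj.symm], ?_⟩
      simp [hxdef]
    · refine ⟨{b'}, by simp [hadj.symm], ?_⟩
      simp [hxdef]

open Classical in
lemma rigid_of_base {C : Type*} [Fintype C] {G : SimpleGraph C} (hconn : G.Connected)
    (b : C) (hdeg : ∀ v, v ≠ b → G.degree v ≤ 2) (φ : Equiv.Perm C)
    (hφ : ∀ i j, G.Adj i j → G.Adj (φ i) (φ j)) (hb : φ b = b)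
    (hN : ∀ k, G.Adj b k → φ k = k) : φ = 1 := by
  have step : ∀ v w, G.Adj v w → (φ v = v ∧ ∀ k, G.Adj v k → φ k = k) →
      (φ w = w ∧ ∀ k, G.Adj w k → φ k = k) := by
    intro v w hvw ⟨hv, hvk⟩
    have hw := hvk w hvw
    refine ⟨hw, fun k hk => ?_⟩
    by_cases hwb : w = b
    · subst hwb; exact hN k hk
    by_contra hne
    have h3 : G.Adj w (φ k) := by have := hφ w k hk; rwa [hw] at this
    have hkv : k ≠ v := fun h => hne (h ▸ hv)
    have hkv' : φ k ≠ v := fun h => hkv (φ.injective (h.trans hv.symm))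
    have hsub : ({v, k, φ k} : Finset C) ⊆ G.neighborFinset w := by
      intro z hz
      simp only [Finset.mem_insert, Finset.mem_singleton] at hz
      rw [SimpleGraph.mem_neighborFinset]
      rcases hz with rfl | rfl | rfl
      · exact hvw.symm
      · exact hk
      · exact h3
    have hc := Finset.card_le_card hsub
    rw [SimpleGraph.card_neighborFinset_eq_degree,
      Finset.card_eq_three.mpr ⟨v, k, φ k, hkv.symm, hkv'.symm, fun h => hne h.symm, rfl⟩] at hc
    have := hdeg w hwb
    omega
  have walk : ∀ v w (p : G.Walk v w), (φ v = v ∧ ∀ k, G.Adj v k → φ k = k) →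
      (φ w = w ∧ ∀ k, G.Adj w k → φ k = k) := by
    intro v w p
    induction p with
    | nil => exact id
    | cons hadj p ih => exact fun hh => ih (step _ _ hadj hh)
  ext v
  obtain ⟨p⟩ := hconn.preconnected b v
  exact (walk _ _ p ⟨hb, hN⟩).1

lemma hom_of_stable {C A : Type*} [Group A] (σ : A →* Equiv.Perm C) (X : Finset C)
    (hX : X.card ≤ 3) (hst : ∀ a, ∀ i, i ∈ X → σ a i ∈ X)
    (hrig : ∀ a, (∀ i ∈ X, σ a i = i) → σ a = 1) :
    ∃ ψ : A →* Equiv.Perm (Fin 3), ∀ a, ψ a = 1 → σ a = 1 := by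
  classical
  have hst' : ∀ a, ∀ i, σ a i ∈ X ↔ i ∈ X := by
    intro a i
    refine ⟨fun h => ?_, hst a i⟩
    have := hst a⁻¹ _ h
    simpa using this
  let τ : A →* Equiv.Perm {i // i ∈ X} :=
    { toFun := fun a => (σ a).subtypePerm (hst' a)
      map_one' := by ext; simp
      map_mul' := fun a b => by
        ext x
        change σ (a * b) x = σ a (σ b x)
        rw [map_mul]; rfl }
  have hcard : Fintype.card {i // i ∈ X} ≤ Fintype.card (Fin 3) := by simpa using hX
  obtain ⟨ι⟩ := Function.Embedding.nonempty_of_card_le hcard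
  refine ⟨(Equiv.Perm.viaEmbeddingHom ι).comp τ, fun a ha => ?_⟩
  have h1 : τ a = 1 := by
    apply Equiv.Perm.viaEmbeddingHom_injective ι
    rw [map_one]; exact ha
  apply hrig
  intro i hi
  have := congrArg (fun f : Equiv.Perm {i // i ∈ X} => (f ⟨i, hi⟩ : C)) h1
  simpa [τ] using this

open Classical in
lemma graph_aut {C A : Type*} [Fintype C] [Group A] {G : SimpleGraph C} (hconn : G.Connected)
    (h : FinType G) (σ : A →* Equiv.Perm C)
    (hσ : ∀ a i j, G.Adj i j → G.Adj (σ a i) (σ a j)) :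
    ∃ ψ : A →* Equiv.Perm (Fin 3), ∀ a, ψ a = 1 → σ a = 1 := by
  have hσ' : ∀ a i j, G.Adj (σ a i) (σ a j) ↔ G.Adj i j := by
    intro a i j
    refine ⟨fun hh => ?_, hσ a i j⟩
    have := hσ a⁻¹ _ _ hh
    simpa using this
  have hdeg : ∀ a i, G.degree (σ a i) = G.degree i := by
    intro a i
    let φ : G ≃g G := ⟨σ a, by intro i j; exact hσ' a i j⟩
    exact φ.degree_eq i
  by_cases hbr : ∃ b, 3 ≤ G.degree b
  · obtain ⟨b, hb⟩ := hbr
    have hfix : ∀ a, σ a b = b := fun a =>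
      h.branch_unique hconn (by rw [hdeg]; exact hb) hb
    refine hom_of_stable σ (G.neighborFinset b) ?_ ?_ ?_
    · rw [SimpleGraph.card_neighborFinset_eq_degree]; exact h.degree_le b
    · intro a i hi
      rw [SimpleGraph.mem_neighborFinset] at hi ⊢
      have := hσ a _ _ hi
      rwa [hfix] at this
    · intro a ha
      refine rigid_of_base hconn b ?_ (σ a) (hσ a) (hfix a) ?_
      · intro v hv
        by_contra hc
        exact hv (h.branch_unique hconn (by omega) hb)
      · intro k hk
        exact ha k (by simpa using hk)
  · push Not at hbr
    have hleaf : ∃ l, G.degree l ≤ 1 := by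
      by_contra hc
      push Not at hc
      obtain ⟨i₀⟩ := hconn.nonempty
      refine h.absurd_of (fun _ => 1) (fun _ => zero_le_one) i₀ one_pos ?_
      intro i _
      refine ⟨G.neighborFinset i, by simp, ?_⟩
      simp only [Finset.sum_const, SimpleGraph.card_neighborFinset_eq_degree, nsmul_eq_mul, mul_one]
      exact_mod_cast hc i
    obtain ⟨l, hl⟩ := hleaf
    refine hom_of_stable σ (Finset.univ.filter fun v => G.degree v ≤ 1) ?_ ?_ ?_
    · have h1 := hconn.card_vert_le_card_edgeSet_add_one
      have h2 := G.sum_degrees_eq_twice_card_edges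
      rw [Nat.card_eq_fintype_card, Nat.card_eq_fintype_card, ← SimpleGraph.edgeFinset_card] at h1
      have h3 : ∑ v, (G.degree v + if G.degree v ≤ 1 then 1 else 0) ≤ ∑ v : C, 2 := by
        refine Finset.sum_le_sum fun v _ => ?_
        have := hbr v
        split_ifs <;> omega
      rw [Finset.sum_add_distrib, h2, ← Finset.card_filter] at h3
      simp only [Finset.sum_const, Finset.card_univ, smul_eq_mul] at h3
      omega
    · intro a i hi
      simpa [hdeg] using hi
    · intro a ha
      have hfix : σ a l = l := ha l (by simpa using hl)
      refine rigid_of_base hconn l (fun v _ => by have := hbr v; omega) (σ a) (hσ a) hfix ?_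
      intro k hk
      have hk' : G.Adj l (σ a k) := by have := hσ a _ _ hk; rwa [hfix] at this
      rw [← SimpleGraph.card_neighborFinset_eq_degree, Finset.card_le_one] at hl
      exact hl _ (by simpa using hk') _ (by simpa using hk)

end GraphPart

section EigenPart

/-- A family of operators acting irreducibly. -/
def IrrFam {ι U : Type*} [AddCommGroup U] [Module ℂ U] (r : ι → Module.End ℂ U) : Prop :=
  (∃ v : U, v ≠ 0) ∧ ∀ K : Submodule ℂ U, (∀ i, ∀ v ∈ K, r i v ∈ K) → K = ⊥ ∨ K = ⊤

lemma exists_eig_in {U : Type*} [AddCommGroup U] [Module ℂ U] [FiniteDimensional ℂ U]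
    (f : Module.End ℂ U) (K : Submodule ℂ U) (hK : K ≠ ⊥) (hf : ∀ v ∈ K, f v ∈ K) :
    ∃ v ∈ K, v ≠ 0 ∧ ∃ c : ℂ, f v = c • v := by
  have : Nontrivial K := Submodule.nontrivial_iff_ne_bot.mpr hK
  obtain ⟨c, hc⟩ := Module.End.exists_eigenvalue (f.restrict hf)
  obtain ⟨v, hv⟩ := hc.exists_hasEigenvector
  refine ⟨v, v.2, ?_, c, ?_⟩
  · intro h
    exact hv.2 (Subtype.ext h)
  · have := congrArg (Subtype.val) hv.apply_eq_smul
    simpa using this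

lemma IrrFam.schur {ι U : Type*} [AddCommGroup U] [Module ℂ U] [FiniteDimensional ℂ U]
    {r : ι → Module.End ℂ U} (h : IrrFam r) (f : Module.End ℂ U)
    (hf : ∀ i v, f (r i v) = r i (f v)) : ∃ c : ℂ, ∀ v, f v = c • v := by
  obtain ⟨v₀, hv₀⟩ := h.1
  have htop : (⊤ : Submodule ℂ U) ≠ ⊥ := by
    intro hh
    exact hv₀ ((Submodule.mem_bot ℂ).mp (hh ▸ Submodule.mem_top))
  obtain ⟨v, -, hv, c, hc⟩ := exists_eig_in f ⊤ htop (fun _ _ => Submodule.mem_top)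
  refine ⟨c, ?_⟩
  have hst : ∀ i, ∀ w ∈ LinearMap.ker (f - c • LinearMap.id),
      r i w ∈ LinearMap.ker (f - c • LinearMap.id) := by
    intro i w hw
    simp only [LinearMap.mem_ker, LinearMap.sub_apply, LinearMap.smul_apply, LinearMap.id_apply,
      sub_eq_zero] at hw ⊢
    rw [hf, hw, map_smul]
  rcases h.2 _ hst with hk | hk
  · exfalso
    apply hv
    have : v ∈ LinearMap.ker (f - c • LinearMap.id) := by simp [hc]
    rw [hk] at this
    simpa using this
  · intro w
    have : w ∈ LinearMap.ker (f - c • LinearMap.id) := hk ▸ Submodule.mem_top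
    simpa [sub_eq_zero] using this

lemma three_involutions {U : Type*} [AddCommGroup U] [Module ℂ U] (a b c T : Module.End ℂ U)
    (ha : a * a = 1) (hb : b * b = 1) (hc : c * c = 1) (hab : a * b = b * a) (hbc : b * c = c * b)
    (hca : c * a = a * c) (h1 : T * a = b * T) (h2 : T * b = c * T) (h3 : T * c = a * T)
    (hT : T * T + T + 1 = 0) : a = b := by
  have conj : ∀ x y z : Module.End ℂ U, x * x = 1 → y * y = 1 → x * y = y * x → y * z = z * y →
      z * x = x * z → T * x = y * T → T * y = z * T → T * z = x * T →
      x * z * T + y * z * (T * T) + 1 = 0 := by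
    intro x y z hx hy hxy hyz hzx e1 e2 e3
    have t1 : T * (x * y) = y * z * T := by
      rw [← mul_assoc, e1, mul_assoc, e2, mul_assoc]
    have t2 : T * (y * z) = z * x * T := by
      rw [← mul_assoc, e2, mul_assoc, e3, mul_assoc]
    have t3 : T * T * (x * y) = z * x * (T * T) := by
      rw [mul_assoc, t1, ← mul_assoc, t2, mul_assoc]
    have p1 : x * y * (y * z) = x * z := by
      rw [mul_assoc, ← mul_assoc y y z, hy, one_mul]
    have p2 : x * y * (z * x) = y * z := by
      rw [hxy, hzx, mul_assoc, ← mul_assoc x x z, hx, one_mul]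
    have p3 : x * y * (x * y) = 1 := by
      rw [hxy, mul_assoc, ← mul_assoc x y, hxy, mul_assoc y x x, hx, mul_one, hy]
    calc x * z * T + y * z * (T * T) + 1
        = x * y * (T * (x * y)) + x * y * (T * T * (x * y)) + x * y * (x * y) := by
          rw [t1, t3, p3, ← mul_assoc (x * y), p1, ← mul_assoc (x * y), p2]
      _ = x * y * ((T * T + T + 1) * (x * y)) := by noncomm_ring
      _ = 0 := by rw [hT]; simp
  have k1 := conj a b c ha hb hab hbc hca h1 h2 h3
  have k2 := conj b c a hb hc hbc hca hab h2 h3 h1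
  have k3 := conj c a b hc ha hca hab hbc h3 h1 h2
  have hTT : T * T + T = -1 := by rw [← sub_eq_zero, sub_neg_eq_add, hT]
  have hS : a * b + b * c + c * a = 1 + 1 + 1 := by
    have e : (a * b + b * c + c * a) * (T * T + T) + (1 + 1 + 1) = 0 := by
      calc (a * b + b * c + c * a) * (T * T + T) + (1 + 1 + 1)
          = (a * c * T + b * c * (T * T) + 1) + (b * a * T + c * a * (T * T) + 1)
            + (c * b * T + a * b * (T * T) + 1) := by
              rw [← hca, ← hab, ← hbc]; noncomm_ring
        _ = 0 := by rw [k1, k2, k3]; simp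
    rw [hTT, mul_neg, mul_one, neg_add_eq_zero] at e
    exact e
  have q1 : a * b * (a * b) = 1 := by
    rw [hab, mul_assoc, ← mul_assoc a b, hab, mul_assoc b a a, ha, mul_one, hb]
  have q2 : a * b * (b * c) = c * a := by
    rw [mul_assoc, ← mul_assoc b b c, hb, one_mul, hca]
  have q3 : a * b * (c * a) = b * c := by
    rw [hab, hca, mul_assoc, ← mul_assoc a a c, ha, one_mul]
  have e4 : (4 : ℂ) • (1 - a * b) = 0 := by
    have : (1 - a * b) * (a * b + b * c + c * a) = - (1 - a * b) := by
      calc (1 - a * b) * (a * b + b * c + c * a)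
          = a * b + b * c + c * a - (a * b * (a * b) + a * b * (b * c) + a * b * (c * a)) := by
            noncomm_ring
        _ = _ := by rw [q1, q2, q3]; abel
    rw [hS] at this
    have h4 : (4 : ℂ) • (1 - a * b) = (1 - a * b) * (1 + 1 + 1) + (1 - a * b) := by
      rw [mul_add, mul_add, mul_one]
      module
    rw [h4, this]; abel
  have e5 : 1 - a * b = 0 := (smul_eq_zero.mp e4).resolve_left (by norm_num)
  have e6 : a * b = 1 := (sub_eq_zero.mp e5).symm
  calc a = a * (b * b) := by rw [hb, mul_one]
    _ = b := by rw [← mul_assoc, e6, one_mul]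

set_option synthInstance.maxSize 2000 in
set_option synthInstance.maxHeartbeats 400000 in
set_option maxRecDepth 10000 in
lemma perm3_a : ∀ x y : Equiv.Perm (Fin 3), x ≠ 1 → y ≠ 1 → x ^ 3 ≠ 1 → y ^ 3 ≠ 1 → x ≠ y →
    (x * y) ^ 3 = 1 ∧ x * y ≠ 1 := by decide

lemma perm3_b : ∀ t x : Equiv.Perm (Fin 3), t ≠ 1 → t ^ 3 = 1 →
    x = 1 ∨ x = t ∨ x = t * t ∨ t * (x * t * x⁻¹) = 1 := by decide

set_option synthInstance.maxSize 2000 in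
set_option synthInstance.maxHeartbeats 400000 in
set_option maxRecDepth 10000 in
lemma perm3_c : ∀ t g x : Equiv.Perm (Fin 3), t ≠ 1 → t ^ 3 = 1 → g ≠ 1 → g ≠ t → g ≠ t * t →
    x = 1 ∨ x = t ∨ x = t * t ∨ x = g ∨ x = t * g ∨ x = t * t * g := by decide

lemma common_eigenvector {C A U : Type*} [Fintype C] [Group A] {G : SimpleGraph C}
    (hconn : G.Connected) (hft : FinType G) (σ : A →* Equiv.Perm C)
    (hσ : ∀ a i j, G.Adj i j → G.Adj (σ a i) (σ a j))
    [AddCommGroup U] [Module ℂ U] [FiniteDimensional ℂ U] (r : C → Module.End ℂ U)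
    (hirr : IrrFam r) (hr2 : ∀ i, r i * r i = 1)
    (hcomm : ∀ i j, ¬ G.Adj i j → r i * r j = r j * r i)
    (J : A → (U ≃ₗ[ℂ] U)) (hJ : ∀ a i v, J a (r i v) = r (σ a i) (J a v)) :
    ∃ v : U, v ≠ 0 ∧ ∀ a, ∃ c : ℂ, J a v = c • v := by
  obtain ⟨ψ, hψ⟩ := graph_aut hconn hft σ hσ
  have hψ' : ∀ a b, ψ a = ψ b → σ a = σ b := by
    intro a b h
    have : σ (a * b⁻¹) = 1 := hψ _ (by rw [map_mul, map_inv, h, mul_inv_cancel])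
    rwa [map_mul, map_inv, mul_inv_eq_one] at this
  obtain ⟨v₀, hv₀⟩ := hirr.1
  have htop : (⊤ : Submodule ℂ U) ≠ ⊥ := by
    intro hh
    exact hv₀ ((Submodule.mem_bot ℂ).mp (hh ▸ Submodule.mem_top))
  -- proportionality
  have prop : ∀ a (F : Module.End ℂ U), (∀ i v, F (r i v) = r (σ a i) (F v)) →
      ∃ c : ℂ, ∀ v, F v = c • J a v := by
    intro a F hF
    obtain ⟨c, hc⟩ := hirr.schur ((J a).symm.toLinearMap ∘ₗ F) (by
      intro i v
      simp only [LinearMap.comp_apply, LinearEquiv.coe_coe]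
      rw [LinearEquiv.symm_apply_eq, hJ, LinearEquiv.apply_symm_apply, hF])
    refine ⟨c, fun v => ?_⟩
    have := hc v
    simp only [LinearMap.comp_apply, LinearEquiv.coe_coe] at this
    rw [LinearEquiv.symm_apply_eq, map_smul] at this
    exact this
  have hE1 : ∀ v : U, ∀ a, ψ a = 1 → ∃ c : ℂ, J a v = c • v := by
    intro v a ha
    obtain ⟨c, hc⟩ := hirr.schur (J a).toLinearMap (by
      intro i v
      have := hJ a i v
      rw [hψ a ha] at this
      exact this)
    exact ⟨c, hc v⟩
  have hEeq : ∀ v : U, ∀ a b, ψ a = ψ b → (∃ c : ℂ, J b v = c • v) → ∃ c : ℂ, J a v = c • v := by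
    intro v a b hab ⟨c, hc⟩
    obtain ⟨d, hd⟩ := prop b (J a).toLinearMap (by
      intro i w; rw [← hψ' a b hab]; exact hJ a i w)
    refine ⟨d * c, ?_⟩
    have := hd v
    rw [hc, smul_smul] at this
    exact this
  have hEmul : ∀ v : U, ∀ a b, (∃ c : ℂ, J a v = c • v) → (∃ c : ℂ, J b v = c • v) →
      ∃ c : ℂ, J (a * b) v = c • v := by
    intro v a b ⟨c, hc⟩ ⟨d, hd⟩
    obtain ⟨e, he⟩ := prop (a * b) ((J a).toLinearMap ∘ₗ (J b).toLinearMap) (by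
      intro i w
      simp only [LinearMap.comp_apply, LinearEquiv.coe_coe, hJ, map_mul, Equiv.Perm.mul_apply])
    have h1 := he v
    simp only [LinearMap.comp_apply, LinearEquiv.coe_coe, hd, map_smul, hc] at h1
    have he0 : e ≠ 0 := by
      intro h0
      have h2 := he ((J b).symm ((J a).symm v₀))
      rw [h0] at h2
      simp at h2
      exact hv₀ h2
    refine ⟨e⁻¹ * (d * c), ?_⟩
    rw [mul_smul, mul_smul, h1, smul_smul, inv_mul_cancel₀ he0, one_smul]
  by_cases ht : ∃ t, ψ t ≠ 1 ∧ ψ t ^ 3 = 1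
  swap
  · push Not at ht
    have hg : ∃ g, ∀ a, ψ a = 1 ∨ ψ a = ψ g := by
      by_cases hg : ∃ g, ψ g ≠ 1
      · obtain ⟨g, hg⟩ := hg
        refine ⟨g, fun a => ?_⟩
        by_contra hc
        push Not at hc
        obtain ⟨h1, h2⟩ := perm3_a (ψ a) (ψ g) hc.1 hg (ht a hc.1) (ht g hg) hc.2
        rw [← map_mul] at h1 h2
        exact ht _ h2 h1
      · push Not at hg
        exact ⟨1, fun a => Or.inl (hg a)⟩
    obtain ⟨g, hg⟩ := hg
    obtain ⟨v, -, hv, hc⟩ := exists_eig_in (J g).toLinearMap ⊤ htop (fun _ _ => Submodule.mem_top)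
    refine ⟨v, hv, fun a => ?_⟩
    rcases hg a with h | h
    · exact hE1 v a h
    · exact hEeq v a g h hc
  obtain ⟨t, ht1, ht3⟩ := ht
  by_cases hg : ∃ g, ψ g ≠ 1 ∧ ψ g ≠ ψ t ∧ ψ g ≠ ψ t * ψ t
  swap
  · push Not at hg
    obtain ⟨v, -, hv, hc⟩ := exists_eig_in (J t).toLinearMap ⊤ htop (fun _ _ => Submodule.mem_top)
    refine ⟨v, hv, fun a => ?_⟩
    by_cases h1 : ψ a = 1
    · exact hE1 v a h1
    by_cases h2 : ψ a = ψ t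
    · exact hEeq v a t h2 hc
    · exact hEeq v a (t * t) (by rw [map_mul]; exact hg a h1 h2) (hEmul v t t hc hc)
  obtain ⟨g, hg1, hg2, hg3⟩ := hg
  -- it suffices to find a common eigenvector of `J t` and `J g`
  suffices hmain : ∃ v : U, v ≠ 0 ∧ (∃ c : ℂ, J t v = c • v) ∧ ∃ c : ℂ, J g v = c • v by
    obtain ⟨v, hv, hvt, hvg⟩ := hmain
    refine ⟨v, hv, fun a => ?_⟩
    rcases perm3_c (ψ t) (ψ g) (ψ a) ht1 ht3 hg1 hg2 hg3 with h | h | h | h | h | h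
    · exact hE1 v a h
    · exact hEeq v a t h hvt
    · exact hEeq v a (t * t) (by rw [map_mul, h]) (hEmul v _ _ hvt hvt)
    · exact hEeq v a g h hvg
    · exact hEeq v a (t * g) (by rw [map_mul, h]) (hEmul v _ _ hvt hvg)
    · exact hEeq v a (t * t * g) (by rw [map_mul, map_mul, h])
        (hEmul v _ _ (hEmul v _ _ hvt hvt) hvg)
  have hσt3 : ∀ i, σ t (σ t (σ t i)) = i := by
    intro i
    have h := hψ (t ^ 3) (by rw [map_pow, ht3])
    have := congrArg (fun f : Equiv.Perm C => f i) h
    simpa [pow_succ] using this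
  have hσg : ∀ i, σ t (σ g (σ t (σ g⁻¹ i))) = i := by
    intro i
    have h4 : ψ (t * (g * t * g⁻¹)) = 1 := by
      rcases perm3_b (ψ t) (ψ g) ht1 ht3 with h | h | h | h
      · exact absurd h hg1
      · exact absurd h hg2
      · exact absurd h hg3
      · simpa using h
    have h := hψ _ h4
    have := congrArg (fun f : Equiv.Perm C => f i) h
    simpa using this
  -- normalise `T`
  obtain ⟨T, μ, hμ, hTJ, hT3, hTg⟩ : ∃ (T : Module.End ℂ U) (μ : ℂ), μ ≠ 0 ∧
      (∀ v, T v = μ • J t v) ∧ (∀ v, T (T (T v)) = v) ∧ (∀ v, T (J g (T v)) = J g v) := by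
    obtain ⟨c, hc⟩ := hirr.schur
      ((J t).toLinearMap ∘ₗ (J t).toLinearMap ∘ₗ (J t).toLinearMap) (by
        intro i v
        simp only [LinearMap.comp_apply, LinearEquiv.coe_coe, hJ, hσt3])
    simp only [LinearMap.comp_apply, LinearEquiv.coe_coe] at hc
    have hc0 : c ≠ 0 := by
      intro h0
      have := hc v₀
      rw [h0] at this
      simp at this
      exact hv₀ this
    obtain ⟨z, hz⟩ := IsAlgClosed.exists_pow_nat_eq (c⁻¹) (n := 3) (by norm_num)
    have hz0 : z ≠ 0 := by
      rintro rfl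
      simp at hz
      exact hc0 hz.symm
    obtain ⟨l, hl⟩ := hirr.schur
      ((z • (J t).toLinearMap) ∘ₗ (J g).toLinearMap ∘ₗ (z • (J t).toLinearMap) ∘ₗ
        (J g).symm.toLinearMap) (by
        intro i v
        have e : (J g).symm (r i v) = r (σ g⁻¹ i) ((J g).symm v) := by
          rw [LinearEquiv.symm_apply_eq, hJ, LinearEquiv.apply_symm_apply, map_inv]
          simp
        simp only [LinearMap.comp_apply, LinearMap.smul_apply, LinearEquiv.coe_coe, e, hJ, hσg,
          map_smul])
    simp only [LinearMap.comp_apply, LinearMap.smul_apply, LinearEquiv.coe_coe] at hl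
    let T₀ : Module.End ℂ U := z • (J t).toLinearMap
    have hT₀ : ∀ v, T₀ (T₀ (T₀ v)) = v := by
      intro v
      simp only [T₀, LinearMap.smul_apply, LinearEquiv.coe_coe, map_smul, hc, smul_smul]
      rw [show z * z * (z * c) = z ^ 3 * c by ring, hz, inv_mul_cancel₀ hc0, one_smul]
    have hTg₀ : ∀ v, T₀ (J g (T₀ v)) = l • J g v := by
      intro v
      have := hl (J g v)
      rw [LinearEquiv.symm_apply_apply] at this
      exact this
    have hTg₁ : ∀ v, J g (T₀ v) = l • T₀ (T₀ (J g v)) := by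
      intro v
      have := congrArg (fun w => T₀ (T₀ w)) (hTg₀ v)
      simpa [hT₀] using this
    have hl3 : l ^ 3 = 1 := by
      have h1 : J g (T₀ (T₀ (T₀ v₀))) = (l ^ 3) • J g v₀ := by
        rw [hTg₁, hTg₁, hTg₁]
        simp only [map_smul, hT₀, smul_smul]
        congr 1; ring
      rw [hT₀] at h1
      have h2 : (1 - l ^ 3) • J g v₀ = 0 := by rw [sub_smul, one_smul, ← h1, sub_self]
      rcases smul_eq_zero.mp h2 with h | h
      · exact (sub_eq_zero.mp h).symm
      · exact absurd ((J g).map_eq_zero_iff.mp h) hv₀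
    have hl0 : l ≠ 0 := by rintro rfl; simp at hl3
    refine ⟨l • T₀, l * z, mul_ne_zero hl0 hz0, ?_, ?_, ?_⟩
    · intro v; simp [T₀, smul_smul]
    · intro v
      simp only [LinearMap.smul_apply, map_smul, hT₀, smul_smul]
      rw [show l * l * l = l ^ 3 by ring, hl3, one_smul]
    · intro v
      simp only [LinearMap.smul_apply, map_smul, hTg₀, smul_smul]
      rw [show l * (l * l) = l ^ 3 by ring, hl3, one_smul]
  have hJt : ∀ v, J t v = μ⁻¹ • T v := fun v => by
    rw [hTJ, smul_smul, inv_mul_cancel₀ hμ, one_smul]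
  have hTr : ∀ i v, T (r i v) = r (σ t i) (T v) := by
    intro i v
    rw [hTJ, hTJ, hJ, map_smul]
  by_cases hker : LinearMap.ker (T - 1) = ⊥
  · -- `T² + T + 1 = 0`
    have hT0 : T * T + T + 1 = 0 := by
      ext v
      have : (T * T + T + 1) v ∈ LinearMap.ker (T - 1) := by
        simp only [LinearMap.mem_ker, LinearMap.sub_apply, LinearMap.add_apply,
          Module.End.mul_apply, Module.End.one_apply, map_add, hT3]
        abel
      rw [hker] at this
      simpa using this
    have hfix : ∀ i, r i = r (σ t i) := by
      intro i
      by_cases hi : σ t i = i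
      · rw [hi]
      have nadj : ∀ j, σ t j ≠ j → ¬ G.Adj j (σ t j) := by
        intro j hj hadj
        have h1 := hσ t _ _ hadj
        have h2 := hσ t _ _ h1
        rw [hσt3] at h2
        exact hft.no_triangle hadj h1 h2
      have hi1 : σ t (σ t i) ≠ σ t i := fun h => hi ((σ t).injective h)
      have hi2 : σ t (σ t (σ t i)) ≠ σ t (σ t i) := fun h => hi1 ((σ t).injective h)
      have n1 := nadj i hi
      have n2 := nadj _ hi1
      have n3 := nadj _ hi2
      rw [hσt3] at n3
      refine three_involutions (r i) (r (σ t i)) (r (σ t (σ t i))) T (hr2 _) (hr2 _) (hr2 _)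
        (hcomm _ _ n1) (hcomm _ _ n2) (hcomm _ _ n3) ?_ ?_ ?_ hT0
      · ext v; exact hTr i v
      · ext v; exact hTr _ v
      · ext v
        have := hTr (σ t (σ t i)) v
        rw [hσt3] at this
        exact this
    obtain ⟨c, hc⟩ := hirr.schur T (by
      intro i v; rw [hTr, ← hfix])
    obtain ⟨v, -, hv, hvg⟩ := exists_eig_in (J g).toLinearMap ⊤ htop (fun _ _ => Submodule.mem_top)
    exact ⟨v, hv, ⟨μ⁻¹ * c, by rw [hJt, hc, smul_smul]⟩, hvg⟩
  · obtain ⟨v, hvK, hv, hvg⟩ := exists_eig_in (J g).toLinearMap _ hker (by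
      intro v hv
      simp only [LinearMap.mem_ker, LinearMap.sub_apply, Module.End.one_apply, sub_eq_zero,
        LinearEquiv.coe_coe] at hv ⊢
      have := hTg v
      rwa [hv] at this)
    simp only [LinearMap.mem_ker, LinearMap.sub_apply, Module.End.one_apply, sub_eq_zero] at hvK
    exact ⟨v, hv, ⟨μ⁻¹, by rw [hJt, hvK]⟩, hvg⟩

end EigenPart

section AssemblyPart

open Classical in
lemma FinType.induce {C : Type*} [Fintype C] {G : SimpleGraph C} (h : FinType G)
    (D : Set C) [Fintype D] : FinType (G.induce D) := by
  intro x hx hs i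
  by_contra hi
  have hi : 0 < x i := lt_of_le_of_ne (hx i) (Ne.symm hi)
  refine h.absurd_of (fun c => if hc : c ∈ D then x ⟨c, hc⟩ else 0) ?_ i.1 ?_ ?_
  · intro c
    by_cases hc : c ∈ D
    · simp [hc, hx]
    · simp [hc]
  · simpa using hi
  · intro c hc
    by_cases hcD : c ∈ D
    · simp only [hcD, dite_true] at hc ⊢
      refine ⟨(Finset.univ.filter fun k : D => (G.induce D).Adj ⟨c, hcD⟩ k).map
        (Function.Embedding.subtype _), ?_, ?_⟩
      · simp +contextual
      · refine (hs _ hc).trans ?_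
        rw [Finset.sum_map, Finset.sum_filter]
        simp
    · simp [hcD] at hc

/-- The subalgebra generated by the operators indexed by `D`. -/
def algOf {ι V : Type*} [AddCommGroup V] [Module ℂ V] (r : ι → Module.End ℂ V) (D : Set ι) :
    Subalgebra ℂ (Module.End ℂ V) := Algebra.adjoin ℂ (r '' D)

lemma mem_algOf {ι V : Type*} [AddCommGroup V] [Module ℂ V] (r : ι → Module.End ℂ V) {D : Set ι}
    {i : ι} (hi : i ∈ D) : r i ∈ algOf r D := Algebra.subset_adjoin ⟨i, hi, rfl⟩

lemma algOf_mono {ι V : Type*} [AddCommGroup V] [Module ℂ V] (r : ι → Module.End ℂ V)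
    {D D' : Set ι} (h : D ⊆ D') : algOf r D ≤ algOf r D' :=
  Algebra.adjoin_mono (Set.image_mono h)

lemma algOf_commute {ι V : Type*} [AddCommGroup V] [Module ℂ V] (r : ι → Module.End ℂ V)
    {D D' : Set ι} (h : ∀ i ∈ D, ∀ j ∈ D', r i * r j = r j * r i)
    {a b : Module.End ℂ V} (ha : a ∈ algOf r D) (hb : b ∈ algOf r D') : a * b = b * a := by
  have h1 : ∀ i ∈ D, Commute (r i) b := by
    intro i hi
    refine Algebra.commute_of_mem_adjoin_of_forall_mem_commute hb ?_
    rintro _ ⟨j, hj, rfl⟩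
    exact h i hi j hj
  refine (Algebra.commute_of_mem_adjoin_of_forall_mem_commute ha ?_).symm
  rintro _ ⟨i, hi, rfl⟩
  exact (h1 i hi).symm

lemma algOf_stable {ι V : Type*} [AddCommGroup V] [Module ℂ V] (r : ι → Module.End ℂ V)
    {D : Set ι} (U : Submodule ℂ V) (hU : ∀ i ∈ D, ∀ v ∈ U, r i v ∈ U)
    {a : Module.End ℂ V} (ha : a ∈ algOf r D) : ∀ v ∈ U, a v ∈ U := by
  induction ha using Algebra.adjoin_induction with
  | mem x hx => obtain ⟨i, hi, rfl⟩ := hx; exact hU i hi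
  | algebraMap c => intro v hv; simpa [Module.algebraMap_end_apply] using U.smul_mem c hv
  | add x y _ _ hx hy => intro v hv; exact U.add_mem (hx v hv) (hy v hv)
  | mul x y _ _ hx hy => intro v hv; exact hx _ (hy v hv)

lemma burnside {ι U : Type*} [AddCommGroup U] [Module ℂ U] [FiniteDimensional ℂ U]
    (r : ι → Module.End ℂ U) (h : IrrFam r) (f : Module.End ℂ U) : f ∈ algOf r Set.univ := by
  let R := algOf r Set.univ
  have hsm : ∀ (a : R) (u : U), a • u = (a : Module.End ℂ U) u := fun a u => rfl
  have : Nontrivial U := by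
    obtain ⟨v, hv⟩ := h.1
    exact ⟨v, 0, hv⟩
  have : IsSimpleModule R U := by
    refine { eq_bot_or_eq_top := fun K => ?_ }
    rcases h.2 (K.restrictScalars ℂ) (fun i v hv =>
      K.smul_mem (⟨r i, mem_algOf r (Set.mem_univ i)⟩ : R) hv) with h1 | h1
    · left
      exact (Submodule.restrictScalars_eq_bot_iff ℂ R U).mp h1
    · right
      exact (Submodule.restrictScalars_eq_top_iff ℂ R U).mp h1
  let F : Module.End (Module.End R U) U :=
    { toFun := f
      map_add' := f.map_add
      map_smul' := by
        intro g u
        obtain ⟨c, hc⟩ := h.schur (g.restrictScalars ℂ) (fun i v => by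
          exact g.map_smul (⟨r i, mem_algOf r (Set.mem_univ i)⟩ : R) v)
        have hc' : ∀ v, g v = c • v := hc
        simp [hc'] }
  classical
  let b := Module.finBasis ℂ U
  obtain ⟨a, ha⟩ := jacobson_density (R := R) F (Finset.univ.image b)
  have : f = a.1 := by
    refine b.ext fun i => ?_
    exact ha (b i) (by simp)
  rw [this]
  exact a.2

/-- A primitive idempotent in the algebra generated by the operators of `D`. -/
def Good {ι V : Type*} [AddCommGroup V] [Module ℂ V] (r : ι → Module.End ℂ V) (D : Set ι)
    (p : Module.End ℂ V) : Prop :=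
  p ∈ algOf r D ∧ p * p = p ∧ p ≠ 0 ∧ ∀ a ∈ algOf r D, ∃ c : ℂ, p * a * p = c • p

/-- Annihilation argument. -/
lemma annih {ι V : Type*} [AddCommGroup V] [Module ℂ V] (r : ι → Module.End ℂ V)
    (h : IrrFam r) (D : Set ι) (hD : ∀ i ∈ D, ∀ j, j ∉ D → r i * r j = r j * r i)
    (p : Module.End ℂ V) (hp : ∀ j, j ∉ D → p * r j = r j * p) (hp0 : p ≠ 0) (v : V)
    (hv : ∀ a ∈ algOf r D, p (a v) = 0) : v = 0 := by
  let K : Submodule ℂ V :=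
    { carrier := {v | ∀ a ∈ algOf r D, p (a v) = 0}
      add_mem' := by intro x y hx hy a ha; simp [hx a ha, hy a ha]
      zero_mem' := by intro a ha; simp
      smul_mem' := by intro c x hx a ha; simp [hx a ha] }
  have hK : ∀ i, ∀ v ∈ K, r i v ∈ K := by
    intro i u hu a ha
    by_cases hi : i ∈ D
    · exact hu (a * r i) (mul_mem ha (mem_algOf r hi))
    · have h1 : a * r i = r i * a :=
        algOf_commute (D' := {i}) r (by rintro k hk j rfl; exact hD k hk _ hi) ha
          (mem_algOf r rfl)
      have h2 : p (a (r i u)) = (p * (a * r i)) u := rfl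
      rw [h2, h1, ← mul_assoc, hp i hi, mul_assoc]
      simp [hu a ha]
  rcases h.2 K hK with h1 | h1
  · have : v ∈ K := hv
    simpa [h1] using this
  · exfalso
    apply hp0
    ext u
    have : u ∈ K := by rw [h1]; trivial
    simpa using this 1 (one_mem _)

end AssemblyPart

section BlockPart

lemma faithful_aux {ι V : Type*} [AddCommGroup V] [Module ℂ V] (r : ι → Module.End ℂ V)
    (h : IrrFam r) (D : Set ι) (hD : ∀ i ∈ D, ∀ j, j ∉ D → r i * r j = r j * r i)
    (U : Submodule ℂ V) (hU : ∀ i ∈ D, ∀ v ∈ U, r i v ∈ U) (hU0 : U ≠ ⊥)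
    (a : Module.End ℂ V) (ha : a ∈ algOf r D) (haU : ∀ u ∈ U, a u = 0) : a = 0 := by
  by_contra ha0
  obtain ⟨u, hu, hu0⟩ := U.ne_bot_iff.mp hU0
  refine hu0 (annih r h D hD a ?_ ha0 u ?_)
  · intro j hj
    exact algOf_commute (D' := {j}) r (by rintro k hk j rfl; exact hD k hk _ hj) ha
      (mem_algOf r rfl)
  · intro b hb
    exact haU _ (algOf_stable r U hU hb u hu)

lemma exists_min_stable {ι V : Type*} [AddCommGroup V] [Module ℂ V] [FiniteDimensional ℂ V]
    (r : ι → Module.End ℂ V) (h0 : ∃ v : V, v ≠ 0) (D : Set ι) :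
    ∃ U : Submodule ℂ V, ∃ hU : (∀ i ∈ D, ∀ v ∈ U, r i v ∈ U), U ≠ ⊥ ∧
      IrrFam (fun i : D => (r i).restrict (hU i i.2)) := by
  obtain ⟨v₀, hv₀⟩ := h0
  have hne : {U : Submodule ℂ V | U ≠ ⊥ ∧ ∀ i ∈ D, ∀ v ∈ U, r i v ∈ U}.Nonempty := by
    refine ⟨⊤, ?_, fun _ _ _ _ => trivial⟩
    intro hh
    exact hv₀ ((Submodule.mem_bot ℂ).mp (hh ▸ Submodule.mem_top))
  obtain ⟨U, ⟨hU0, hU⟩, hmin⟩ := (wellFounded_lt (α := Submodule ℂ V)).has_min _ hne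
  refine ⟨U, hU, hU0, ?_, ?_⟩
  · obtain ⟨u, hu, hu0⟩ := U.ne_bot_iff.mp hU0
    exact ⟨⟨u, hu⟩, fun h => hu0 (congrArg Subtype.val h)⟩
  · intro K hK
    by_cases hKb : K = ⊥
    · exact Or.inl hKb
    right
    have h1 : K.map U.subtype ≠ ⊥ := by
      intro h
      obtain ⟨k, hk, hk0⟩ := K.ne_bot_iff.mp hKb
      have h1 : (k : V) ∈ K.map U.subtype := ⟨k, hk, rfl⟩
      rw [h, Submodule.mem_bot] at h1
      exact hk0 (Subtype.ext h1)
    have h2 := hmin (K.map U.subtype) ⟨h1, ?_⟩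
    · have h3 : K.map U.subtype ≤ U := Submodule.map_subtype_le U K
      have h4 : K.map U.subtype = U := by
        by_contra h5
        exact h2 (lt_of_le_of_ne h3 h5)
      rw [eq_top_iff]
      intro u _
      have : (u : V) ∈ K.map U.subtype := by rw [h4]; exact u.2
      obtain ⟨k, hk, hku⟩ := this
      have : k = u := Subtype.ext hku
      exact this ▸ hk
    · rintro i hi _ ⟨k, hk, rfl⟩
      exact ⟨_, hK ⟨i, hi⟩ k hk, rfl⟩

lemma lift_alg {ι V : Type*} [AddCommGroup V] [Module ℂ V] (r : ι → Module.End ℂ V)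
    (D : Set ι) (U : Submodule ℂ V) (hU : ∀ i ∈ D, ∀ v ∈ U, r i v ∈ U)
    (g : Module.End ℂ U)
    (hg : g ∈ algOf (fun i : D => (r i).restrict (hU i i.2)) Set.univ) :
    ∃ p ∈ algOf r D, ∀ u : U, p (u : V) = (g u : V) := by
  induction hg using Algebra.adjoin_induction with
  | mem x hx =>
    obtain ⟨i, hi, rfl⟩ := hx
    exact ⟨r i, mem_algOf r i.2, fun u => rfl⟩
  | algebraMap c =>
    exact ⟨algebraMap ℂ _ c, Subalgebra.algebraMap_mem _ c, fun u => rfl⟩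
  | add x y _ _ hx hy =>
    obtain ⟨p, hp, hp'⟩ := hx
    obtain ⟨q, hq, hq'⟩ := hy
    exact ⟨p + q, add_mem hp hq, fun u => by simp [hp', hq']⟩
  | mul x y _ _ hx hy =>
    obtain ⟨p, hp, hp'⟩ := hx
    obtain ⟨q, hq, hq'⟩ := hy
    exact ⟨p * q, mul_mem hp hq, fun u => by simp [hp', hq']⟩

lemma exists_J {ι V : Type*} [AddCommGroup V] [Module ℂ V] [FiniteDimensional ℂ V]
    (r : ι → Module.End ℂ V) (h : IrrFam r) (D : Set ι)
    (hD : ∀ i ∈ D, ∀ j, j ∉ D → r i * r j = r j * r i)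
    (U : Submodule ℂ V) (hU : ∀ i ∈ D, ∀ v ∈ U, r i v ∈ U) (hU0 : U ≠ ⊥)
    (hirr : IrrFam (fun i : D => (r i).restrict (hU i i.2)))
    (q : Module.End ℂ V) (hq1 : ∀ v, q v ∈ U) (hq2 : ∀ v ∈ U, q v = v)
    (hq3 : ∀ i ∈ D, q * r i = r i * q)
    (τ : ι → ι) (hτ : ∀ i ∈ D, τ i ∈ D) (E : V ≃ₗ[ℂ] V) (hE : ∀ i v, E (r i v) = r (τ i) (E v)) :
    ∃ J : U ≃ₗ[ℂ] U, ∀ i ∈ D, ∀ u u' : U, (u' : V) = r i u → (J u' : V) = r (τ i) (J u) := by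
  obtain ⟨u₀, hu₀, hu0⟩ := U.ne_bot_iff.mp hU0
  have hx : ∃ x ∈ algOf r Dᶜ, q (x (E u₀)) ≠ 0 := by
    by_contra hcon
    push Not at hcon
    have := annih r h Dᶜ ?_ q ?_ ?_ (E u₀) hcon
    · exact hu0 (by simpa using this)
    · intro i hi j hj
      exact (hD j (by simpa using hj) i hi).symm
    · intro j hj
      exact hq3 j (by simpa using hj)
    · intro hq0
      apply hu0
      rw [← hq2 u₀ hu₀, hq0]; rfl
  obtain ⟨x, hx, hx0⟩ := hx
  let J₀ : U →ₗ[ℂ] U :=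
    LinearMap.codRestrict U (q ∘ₗ x ∘ₗ E.toLinearMap ∘ₗ U.subtype) (fun _ => hq1 _)
  have hJ₀v : ∀ u : U, (J₀ u : V) = q (x (E u)) := fun u => rfl
  have hxr : ∀ i ∈ D, x * r i = r i * x := by
    intro i hi
    exact algOf_commute (D' := {i}) r (by
      rintro k hk j rfl
      exact (hD _ hi k hk).symm) hx (mem_algOf r rfl)
  have hJ₀ : ∀ i ∈ D, ∀ u u' : U, (u' : V) = r i u → (J₀ u' : V) = r (τ i) (J₀ u) := by
    intro i hi u u' huu
    rw [hJ₀v, hJ₀v, huu, hE]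
    have h1 := LinearMap.congr_fun (hxr _ (hτ i hi)) (E u)
    have h2 := LinearMap.congr_fun (hq3 _ (hτ i hi)) (x (E u))
    simp only [Module.End.mul_apply] at h1 h2
    rw [h1, h2]
  have hker : LinearMap.ker J₀ = ⊥ := by
    rcases hirr.2 (LinearMap.ker J₀) (by
      intro i u hu
      rw [LinearMap.mem_ker] at hu ⊢
      apply Subtype.ext
      rw [hJ₀ i i.2 u _ rfl, hu]
      simp) with h1 | h1
    · exact h1
    · exfalso
      apply hx0
      have : (⟨u₀, hu₀⟩ : U) ∈ LinearMap.ker J₀ := by rw [h1]; trivial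
      exact congrArg Subtype.val (LinearMap.mem_ker.mp this)
  exact ⟨LinearEquiv.ofInjectiveEndo J₀ (LinearMap.ker_eq_bot.mp hker), hJ₀⟩

lemma twist_alg {ι V : Type*} [AddCommGroup V] [Module ℂ V]
    (r : ι → Module.End ℂ V) (D : Set ι)
    (U : Submodule ℂ V) (hU : ∀ i ∈ D, ∀ v ∈ U, r i v ∈ U)
    (τ : ι → ι) (hτ : ∀ i ∈ D, τ i ∈ D) (E : V ≃ₗ[ℂ] V) (hE : ∀ i v, E (r i v) = r (τ i) (E v))
    (J : U ≃ₗ[ℂ] U) (hJ : ∀ i ∈ D, ∀ u u' : U, (u' : V) = r i u → (J u' : V) = r (τ i) (J u))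
    (b : Module.End ℂ V) (hb : b ∈ algOf r D) :
    ∃ b' ∈ algOf r D, (∀ w, E (b w) = b' (E w)) ∧
      ∀ u u' : U, (u' : V) = b u → (J u' : V) = b' (J u) := by
  induction hb using Algebra.adjoin_induction with
  | mem x hx =>
    obtain ⟨i, hi, rfl⟩ := hx
    exact ⟨r (τ i), mem_algOf r (hτ i hi), hE i, hJ i hi⟩
  | algebraMap c =>
    refine ⟨algebraMap ℂ _ c, Subalgebra.algebraMap_mem _ c, fun w => ?_, fun u u' huu => ?_⟩
    · simp [Module.algebraMap_end_apply]
    · have : u' = c • u := Subtype.ext huu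
      rw [this]; simp [Module.algebraMap_end_apply]
  | add x y hx hy ihx ihy =>
    obtain ⟨p, hp, hp1, hp2⟩ := ihx
    obtain ⟨q, hq, hq1, hq2⟩ := ihy
    refine ⟨p + q, add_mem hp hq, fun w => by simp [hp1, hq1], fun u u' huu => ?_⟩
    have h1 := hp2 u ⟨x u, algOf_stable r U hU hx u u.2⟩ rfl
    have h2 := hq2 u ⟨y u, algOf_stable r U hU hy u u.2⟩ rfl
    have : u' = ⟨x u, algOf_stable r U hU hx u u.2⟩ + ⟨y u, algOf_stable r U hU hy u u.2⟩ :=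
      Subtype.ext huu
    rw [this, map_add, Submodule.coe_add, h1, h2]; rfl
  | mul x y hx hy ihx ihy =>
    obtain ⟨p, hp, hp1, hp2⟩ := ihx
    obtain ⟨q, hq, hq1, hq2⟩ := ihy
    refine ⟨p * q, mul_mem hp hq, fun w => by simp [hp1, hq1], fun u u' huu => ?_⟩
    have h2 := hq2 u ⟨y u, algOf_stable r U hU hy u u.2⟩ rfl
    rw [hp2 ⟨y u, algOf_stable r U hU hy u u.2⟩ u' huu, h2]; rfl

lemma block {B A V : Type*} [Fintype B] [Group A] [AddCommGroup V] [Module ℂ V]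
    [FiniteDimensional ℂ V] {G : SimpleGraph B} (hft : FinType G)
    (r : B → Module.End ℂ V) (hirr : IrrFam r) (hr2 : ∀ i, r i * r i = 1)
    (hcomm : ∀ i j, ¬ G.Adj i j → r i * r j = r j * r i)
    (D : Set B) (hDc : (G.induce D).Connected) (hD : ∀ i ∈ D, ∀ j, j ∉ D → ¬ G.Adj i j)
    (σ : A →* Equiv.Perm B) (hσ : ∀ a i j, G.Adj i j → G.Adj (σ a i) (σ a j))
    (hσD : ∀ a, ∀ i ∈ D, σ a i ∈ D)
    (E : A → (V ≃ₗ[ℂ] V)) (hE : ∀ a i v, E a (r i v) = r (σ a i) (E a v))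
    (hq : ∀ U : Submodule ℂ V, (∀ i ∈ D, ∀ v ∈ U, r i v ∈ U) →
      ∃ q : Module.End ℂ V, (∀ v, q v ∈ U) ∧ (∀ v ∈ U, q v = v) ∧
        ∀ i ∈ D, q * r i = r i * q) :
    ∃ p, Good r D p ∧ ∀ a v, p v = v → p (E a v) = E a v := by
  classical
  have hD' : ∀ i ∈ D, ∀ j, j ∉ D → r i * r j = r j * r i :=
    fun i hi j hj => hcomm i j (hD i hi j hj)
  obtain ⟨U, hU, hU0, hUirr⟩ := exists_min_stable r hirr.1 D
  obtain ⟨q, hq1, hq2, hq3⟩ := hq U hU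
  choose J hJ using fun a =>
    exists_J r hirr D hD' U hU hU0 hUirr q hq1 hq2 hq3 (σ a) (hσD a) (E a) (hE a)
  have hiff : ∀ a i, σ a i ∈ D ↔ i ∈ D := by
    intro a i
    refine ⟨fun h => ?_, hσD a i⟩
    have := hσD a⁻¹ _ h
    rwa [← Equiv.Perm.mul_apply, ← map_mul, inv_mul_cancel, map_one, Equiv.Perm.one_apply] at this
  let σD : A →* Equiv.Perm D :=
    { toFun := fun a => (σ a).subtypePerm (hiff a)
      map_one' := by ext i; simp
      map_mul' := by 
        intro a b
        ext i
        change σ (a * b) i = σ a (σ b i)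
        rw [map_mul, Equiv.Perm.mul_apply] }
  obtain ⟨v, hv, hJv⟩ := common_eigenvector hDc (hft.induce D) σD
    (fun a i j hij => hσ a i j hij) (fun i : D => (r i).restrict (hU i i.2)) hUirr
    (by
      intro i; ext u
      exact LinearMap.congr_fun (hr2 i) (u : V))
    (by
      intro i j hij; ext u
      exact LinearMap.congr_fun (hcomm i j hij) (u : V))
    J (by
      intro a i u
      apply Subtype.ext
      exact hJ a i i.2 u _ rfl)
  obtain ⟨f, hf⟩ := Module.Projective.exists_dual_eq_one ℂ hv
  obtain ⟨p, hp, hpU⟩ := lift_alg r D U hU (f.smulRight v) (burnside _ hUirr _)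
  have hpU' : ∀ u : U, p (u : V) = f u • (v : V) := by
    intro u; rw [hpU]; rfl
  have hpv : p (v : V) = v := by rw [hpU', hf, one_smul]
  have hv' : (v : V) ≠ 0 := fun h => hv (Subtype.ext h)
  have faith : ∀ x ∈ algOf r D, ∀ y ∈ algOf r D, (∀ u : U, x (u : V) = y u) → x = y := by
    intro x hx y hy hxy
    rw [← sub_eq_zero]
    refine faithful_aux r hirr D hD' U hU hU0 _ (sub_mem hx hy) ?_
    intro u hu
    simpa [sub_eq_zero] using hxy ⟨u, hu⟩
  refine ⟨p, ⟨hp, ?_, ?_, ?_⟩, ?_⟩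
  · refine faith _ (mul_mem hp hp) _ hp fun u => ?_
    rw [Module.End.mul_apply, hpU', map_smul, hpv]
  · intro h
    rw [h] at hpv
    exact hv' hpv.symm
  · intro a ha
    refine ⟨f ⟨a v, algOf_stable r U hU ha v v.2⟩, ?_⟩
    refine faith _ (mul_mem (mul_mem hp ha) hp) _ (Subalgebra.smul_mem _ hp _) fun u => ?_
    have h1 := hpU' ⟨a v, algOf_stable r U hU ha v v.2⟩
    simp only at h1
    rw [Module.End.mul_apply, Module.End.mul_apply, LinearMap.smul_apply, hpU', map_smul, map_smul,
      h1, smul_comm]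
  · intro a w hw
    obtain ⟨p', hp', hp1, hp2⟩ := twist_alg r D U hU (σ a) (hσD a) (E a) (hE a) (J a) (hJ a) p hp
    have hpp : p * p' = p' := by
      refine faith _ (mul_mem hp hp') _ hp' fun u => ?_
      obtain ⟨u, rfl⟩ := (J a).surjective u
      obtain ⟨c, hc⟩ := hJv a
      have h1 := hp2 u (f u • v) (by rw [hpU']; rfl)
      rw [Module.End.mul_apply, ← h1, map_smul, hc]
      simp [hpv]
    have h2 := hp1 w
    rw [hw] at h2
    have h3 := LinearMap.congr_fun hpp (E a w)
    rw [Module.End.mul_apply, ← h2] at h3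
    exact h3

end BlockPart

section ProductPart

lemma Good.transport {ι V : Type*} [AddCommGroup V] [Module ℂ V] {r : ι → Module.End ℂ V}
    {D : Set ι} {p : Module.End ℂ V} (h : Good r D p) (τ : ι → ι) (E : V ≃ₗ[ℂ] V)
    (hE : ∀ i v, E (r i v) = r (τ i) (E v)) :
    ∃ p', Good r (τ '' D) p' ∧ ∀ v, p' v = v ↔ p (E.symm v) = E.symm v := by
  let φ : Module.End ℂ V ≃ₐ[ℂ] Module.End ℂ V := E.conjAlgEquiv ℂ
  have hφ : ∀ x v, φ x v = E (x (E.symm v)) := fun x v => rfl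
  have hφr : ∀ i, φ (r i) = r (τ i) := by
    intro i; ext v
    rw [hφ, hE, E.apply_symm_apply]
  have hmap : (algOf r D).map φ.toAlgHom = algOf r (τ '' D) := by
    unfold algOf
    rw [AlgHom.map_adjoin]
    congr 1
    rw [Set.image_image, Set.image_image]
    refine Set.image_congr fun i _ => hφr i
  refine ⟨φ p, ⟨?_, ?_, ?_, ?_⟩, ?_⟩
  · rw [← hmap]; exact ⟨p, h.1, rfl⟩
  · rw [← map_mul, h.2.1]
  · exact (map_ne_zero_iff φ φ.injective).mpr h.2.2.1
  · intro a ha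
    rw [← hmap] at ha
    obtain ⟨b, hb, rfl⟩ := ha
    obtain ⟨c, hc⟩ := h.2.2.2 b hb
    refine ⟨c, ?_⟩
    change φ p * φ b * φ p = c • φ p
    rw [← map_mul, ← map_mul, hc, map_smul]
  · intro v
    rw [hφ, E.eq_symm_apply]

lemma algOf_union {ι V : Type*} [AddCommGroup V] [Module ℂ V] (r : ι → Module.End ℂ V)
    {D D' : Set ι} (hDD : ∀ i ∈ D, ∀ j ∈ D', r i * r j = r j * r i)
    {x : Module.End ℂ V} (hx : x ∈ algOf r (D ∪ D')) :
    x ∈ (algOf r D).toSubmodule * (algOf r D').toSubmodule := by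
  have hcom : (algOf r D').toSubmodule * (algOf r D).toSubmodule =
      (algOf r D).toSubmodule * (algOf r D').toSubmodule :=
    Submodule.mul_comm_of_commute fun a ha b hb => (algOf_commute r hDD hb ha).symm
  induction hx using Algebra.adjoin_induction with
  | mem x hx =>
    obtain ⟨i, hi | hi, rfl⟩ := hx
    · have := Submodule.mul_mem_mul (show r i ∈ (algOf r D).toSubmodule from mem_algOf r hi)
        (show 1 ∈ (algOf r D').toSubmodule from one_mem (algOf r D'))
      simpa using this
    · have := Submodule.mul_mem_mul (show 1 ∈ (algOf r D).toSubmodule from one_mem (algOf r D))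
        (show r i ∈ (algOf r D').toSubmodule from mem_algOf r hi)
      simpa using this
  | algebraMap c =>
    have := Submodule.mul_mem_mul
      (show algebraMap ℂ _ c ∈ (algOf r D).toSubmodule from Subalgebra.algebraMap_mem (algOf r D) c)
      (show 1 ∈ (algOf r D').toSubmodule from one_mem (algOf r D'))
    simpa using this
  | add x y _ _ hx hy => exact add_mem hx hy
  | mul x y _ _ hx hy =>
    have h := Submodule.mul_mem_mul hx hy
    rw [mul_assoc, ← mul_assoc (algOf r D').toSubmodule, hcom, mul_assoc, ← mul_assoc,
      (Subalgebra.isIdempotentElem_toSubmodule (algOf r D)).eq,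
      (Subalgebra.isIdempotentElem_toSubmodule (algOf r D')).eq] at h
    exact h

lemma Good.mul {ι V : Type*} [AddCommGroup V] [Module ℂ V] {r : ι → Module.End ℂ V}
    (hirr : IrrFam r) {D D' : Set ι} {p p' : Module.End ℂ V} (h : Good r D p) (h' : Good r D' p')
    (hD : ∀ i ∈ D, ∀ j, j ∉ D → r i * r j = r j * r i) (hdisj : Disjoint D D') :
    Good r (D ∪ D') (p * p') ∧ ∀ v, (p * p') v = v ↔ p v = v ∧ p' v = v := by
  have hDD : ∀ i ∈ D, ∀ j ∈ D', r i * r j = r j * r i :=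
    fun i hi j hj => hD i hi j (fun hjD => Set.disjoint_left.mp hdisj hjD hj)
  have cc : ∀ a ∈ algOf r D, ∀ b ∈ algOf r D', a * b = b * a :=
    fun a ha b hb => algOf_commute r hDD ha hb
  have hpp := cc p h.1 p' h'.1
  refine ⟨⟨?_, ?_, ?_, ?_⟩, ?_⟩
  · exact mul_mem (algOf_mono r Set.subset_union_left h.1)
      (algOf_mono r Set.subset_union_right h'.1)
  · calc p * p' * (p * p') = p * (p' * p) * p' := by simp only [mul_assoc]
      _ = (p * p) * (p' * p') := by rw [← hpp]; simp only [mul_assoc]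
      _ = p * p' := by rw [h.2.1, h'.2.1]
  · intro h0
    apply h'.2.2.1
    ext w
    refine annih r hirr D hD p ?_ h.2.2.1 _ ?_
    · intro j hj
      exact algOf_commute (D' := {j}) r (by rintro k hk j rfl; exact hD k hk _ hj) h.1
        (mem_algOf r rfl)
    · intro a ha
      have h1 : p (a (p' w)) = (p * (a * p')) w := rfl
      rw [h1, cc a ha p' h'.1, ← mul_assoc, h0]
      simp
  · intro x hx
    have hx' := algOf_union r hDD hx
    refine Submodule.mul_induction_on hx' ?_ ?_
    · intro a ha b hb
      obtain ⟨c, hc⟩ := h.2.2.2 a ha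
      obtain ⟨c', hc'⟩ := h'.2.2.2 b hb
      refine ⟨c * c', ?_⟩
      calc p * p' * (a * b) * (p * p') = p * (p' * a) * (b * p) * p' := by simp only [mul_assoc]
        _ = p * a * (p' * p) * b * p' := by
          rw [← cc a ha p' h'.1, ← cc p h.1 b hb]; simp only [mul_assoc]
        _ = (p * a * p) * (p' * b * p') := by rw [← hpp]; simp only [mul_assoc]
        _ = (c * c') • (p * p') := by rw [hc, hc', smul_mul_smul_comm]
    · rintro x y ⟨c, hc⟩ ⟨c', hc'⟩
      exact ⟨c + c', by rw [mul_add, add_mul, hc, hc', add_smul]⟩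
  · intro v
    constructor
    · intro hv
      constructor
      · rw [← hv, ← Module.End.mul_apply, ← mul_assoc, h.2.1]
      · rw [← hv, ← Module.End.mul_apply, ← mul_assoc, ← hpp, mul_assoc, h'.2.1]
    · rintro ⟨h1, h2⟩
      rw [Module.End.mul_apply, h2, h1]

lemma good_iUnion {ι κ V : Type*} [AddCommGroup V] [Module ℂ V] {r : ι → Module.End ℂ V}
    (hirr : IrrFam r) (D : κ → Set ι) (p : κ → Module.End ℂ V) (h : ∀ c, Good r (D c) (p c))
    (hD : ∀ c, ∀ i ∈ D c, ∀ j, j ∉ D c → r i * r j = r j * r i)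
    (hdisj : ∀ c c', c ≠ c' → Disjoint (D c) (D c')) (t : Finset κ) :
    ∃ P, Good r (⋃ c ∈ t, D c) P ∧ ∀ v, P v = v ↔ ∀ c ∈ t, p c v = v := by
  classical
  induction t using Finset.induction_on with
  | empty =>
    refine ⟨1, ⟨one_mem _, one_mul 1, ?_, ?_⟩, by simp⟩
    · intro h1
      obtain ⟨v, hv⟩ := hirr.1
      exact hv (by simpa using LinearMap.congr_fun h1 v)
    · intro a ha
      have : algOf r (⋃ c ∈ (∅ : Finset κ), D c) = ⊥ := by simp [algOf]
      rw [this] at ha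
      obtain ⟨c, rfl⟩ := Algebra.mem_bot.mp ha
      exact ⟨c, by rw [one_mul, mul_one, Algebra.algebraMap_eq_smul_one]⟩
  | insert c t hc ih =>
    obtain ⟨P, hP, hP'⟩ := ih
    obtain ⟨h1, h2⟩ := (h c).mul hirr hP (hD c) (by
      simp only [Set.disjoint_iUnion_right]
      intro c' hc'
      exact hdisj c c' (fun hcc => hc (hcc ▸ hc')))
    refine ⟨p c * P, ?_, ?_⟩
    · rwa [Finset.set_biUnion_insert]
    · intro v
      rw [h2, hP', Finset.forall_mem_insert]

lemma Good.rank_one {ι V : Type*} [AddCommGroup V] [Module ℂ V] [FiniteDimensional ℂ V]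
    {r : ι → Module.End ℂ V} (hirr : IrrFam r) {P : Module.End ℂ V} (h : Good r Set.univ P) :
    ∃ v₁, v₁ ≠ 0 ∧ P v₁ = v₁ ∧ ∀ v, P v = v → ∃ c : ℂ, v = c • v₁ := by
  obtain ⟨w, hw⟩ : ∃ w, P w ≠ 0 := by
    by_contra hcon
    push Not at hcon
    exact h.2.2.1 (LinearMap.ext hcon)
  have hPw : P (P w) = P w := LinearMap.congr_fun h.2.1 w
  refine ⟨P w, hw, hPw, fun v hv => ?_⟩
  obtain ⟨f, hf⟩ := Module.Projective.exists_dual_eq_one ℂ hw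
  obtain ⟨c, hc⟩ := h.2.2.2 (f.smulRight v) (burnside r hirr _)
  refine ⟨c, ?_⟩
  have := LinearMap.congr_fun hc (P w)
  simpa [hPw, hf, hv] using this

lemma average {W V : Type*} [Group W] [Fintype W] [AddCommGroup V] [Module ℂ V]
    (π : W →* (V →ₗ[ℂ] V)) (H : Subgroup W) (U : Submodule ℂ V)
    (hU : ∀ h ∈ H, ∀ v ∈ U, π h v ∈ U) :
    ∃ q : Module.End ℂ V, (∀ v, q v ∈ U) ∧ (∀ v ∈ U, q v = v) ∧
        ∀ h ∈ H, q * π h = π h * q := by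
  classical
  have hpi : ∀ g g' v, π g (π g' v) = π (g * g') v := by
    intro g g' v; rw [map_mul]; rfl
  obtain ⟨g, hg⟩ := LinearMap.exists_leftInverse_of_injective U.subtype (Submodule.ker_subtype U)
  have hg' : ∀ u (hu : u ∈ U), (g u : V) = u := fun u hu =>
    congrArg Subtype.val (LinearMap.congr_fun hg ⟨u, hu⟩)
  let q₀ : Module.End ℂ V := U.subtype ∘ₗ g
  let q₁ : Module.End ℂ V := ∑ h : H, π h * q₀ * π (h⁻¹ : H)
  have hcard : (Fintype.card H : ℂ) ≠ 0 := by exact_mod_cast Fintype.card_ne_zero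
  have hq₁ : ∀ v, q₁ v = ∑ h : H, π h (g (π (h⁻¹ : H) v)) := by
    intro v
    simp [q₁, q₀, LinearMap.sum_apply]
  refine ⟨(Fintype.card H : ℂ)⁻¹ • q₁, ?_, ?_, ?_⟩
  · intro v
    rw [LinearMap.smul_apply, hq₁]
    exact U.smul_mem _ (U.sum_mem fun h _ => hU h h.2 _ (g _).2)
  · intro v hv
    have : ∀ h : H, π h (g (π (h⁻¹ : H) v)) = v := by
      intro h
      rw [hg' _ (hU _ (h⁻¹).2 _ hv), hpi]
      simp
    rw [LinearMap.smul_apply, hq₁, Finset.sum_congr rfl (fun h _ => this h)]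
    rw [Finset.sum_const, Finset.card_univ, ← Nat.cast_smul_eq_nsmul ℂ, smul_smul,
      inv_mul_cancel₀ hcard, one_smul]
  · intro k hk
    ext v
    rw [Module.End.mul_apply, Module.End.mul_apply, LinearMap.smul_apply, LinearMap.smul_apply,
      map_smul, hq₁, hq₁, map_sum]
    congr 1
    refine (Fintype.sum_equiv (Equiv.mulLeft (⟨k, hk⟩ : H)) _ _ fun h => ?_).symm
    simp only [Equiv.coe_mulLeft, hpi, mul_inv_rev, Subgroup.coe_mul, InvMemClass.coe_inv]
    simp

end ProductPart

section FinalPart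

lemma schur_prop {ι V : Type*} [AddCommGroup V] [Module ℂ V] [FiniteDimensional ℂ V]
    {r : ι → Module.End ℂ V} (hirr : IrrFam r) (τ : ι → ι) (E F : V ≃ₗ[ℂ] V)
    (hE : ∀ i v, E (r i v) = r (τ i) (E v)) (hF : ∀ i v, F (r i v) = r (τ i) (F v)) :
    ∃ k : ℂ, ∀ v, E v = k • F v := by
  obtain ⟨k, hk⟩ := hirr.schur (F.symm.toLinearMap ∘ₗ E.toLinearMap) (by
    intro i v
    apply F.injective
    simp [hE, hF])
  refine ⟨k, fun v => ?_⟩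
  have := congrArg F (hk v)
  simpa using this

lemma exists_line {B A V : Type*} [Fintype B] [Group A] [AddCommGroup V] [Module ℂ V]
    [FiniteDimensional ℂ V] {G : SimpleGraph B} (hft : FinType G)
    (r : B → Module.End ℂ V) (hirr : IrrFam r) (hr2 : ∀ i, r i * r i = 1)
    (hcomm : ∀ i j, ¬ G.Adj i j → r i * r j = r j * r i)
    (σ : A →* Equiv.Perm B) (hσ : ∀ a i j, G.Adj i j → G.Adj (σ a i) (σ a j))
    (E : A → (V ≃ₗ[ℂ] V)) (hE : ∀ a i v, E a (r i v) = r (σ a i) (E a v))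
    (hq : ∀ (D : Set B) (U : Submodule ℂ V), (∀ i ∈ D, ∀ v ∈ U, r i v ∈ U) →
      ∃ q : Module.End ℂ V, (∀ v, q v ∈ U) ∧ (∀ v ∈ U, q v = v) ∧
        ∀ i ∈ D, q * r i = r i * q) :
    ∃ v, v ≠ 0 ∧ ∀ a, ∃ c : ℂ, E a v = c • v := by
  classical
  have hE2 : ∀ a b i v, E a (E b (r i v)) = r (σ (a * b) i) (E a (E b v)) := by
    intro a b i v
    rw [hE, hE, map_mul, Equiv.Perm.mul_apply]
  have prop1 : ∀ a b, ∃ k : ℂ, ∀ v, E a (E b v) = k • E (a * b) v := fun a b =>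
    schur_prop hirr (σ (a * b)) ((E b).trans (E a)) (E (a * b)) (hE2 a b) (hE (a * b))
  have prop2 : ∀ a b, ∃ k : ℂ, ∀ v, E (a * b) v = k • E a (E b v) := fun a b =>
    schur_prop hirr (σ (a * b)) (E (a * b)) ((E b).trans (E a)) (hE (a * b)) (hE2 a b)
  let m : A → G.ConnectedComponent → G.ConnectedComponent :=
    fun a c => c.map ⟨σ a, fun {i j} h => hσ a i j h⟩
  have hm : ∀ a i, m a (G.connectedComponentMk i) = G.connectedComponentMk (σ a i) :=
    fun a i => rfl
  let : MulAction A G.ConnectedComponent :=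
    { smul := m
      one_smul := by
        intro c
        induction c using SimpleGraph.ConnectedComponent.ind with
        | h i =>
          change m 1 _ = _
          rw [hm, map_one, Equiv.Perm.one_apply]
      mul_smul := by
        intro a b c
        induction c using SimpleGraph.ConnectedComponent.ind with
        | h i =>
          change m (a * b) _ = m a (m b _)
          rw [hm, hm, hm, map_mul, Equiv.Perm.mul_apply] }
  have hsm : ∀ (a : A) i, a • G.connectedComponentMk i = G.connectedComponentMk (σ a i) := hm
  have hnadj : ∀ c : G.ConnectedComponent, ∀ i ∈ c.supp, ∀ j, j ∉ c.supp → ¬ G.Adj i j := by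
    intro c i hi j hj hadj
    rw [SimpleGraph.ConnectedComponent.mem_supp_iff] at hi hj
    apply hj
    rw [← hi]
    exact SimpleGraph.ConnectedComponent.sound hadj.symm.reachable
  have hsupp : ∀ (a : A) (c : G.ConnectedComponent), σ a '' c.supp = (a • c).supp := by
    intro a c
    ext j
    simp only [Set.mem_image, SimpleGraph.ConnectedComponent.mem_supp_iff]
    constructor
    · rintro ⟨i, rfl, rfl⟩
      rw [hsm]
    · intro hj
      refine ⟨σ a⁻¹ j, ?_, ?_⟩
      · rw [← hsm, hj, inv_smul_smul]
      · rw [← Equiv.Perm.mul_apply, ← map_mul, mul_inv_cancel, map_one, Equiv.Perm.one_apply]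
  have hblock : ∀ c : G.ConnectedComponent, ∃ p, Good r c.supp p ∧
      ∀ a : A, a • c = c → ∀ v, p v = v → p (E a v) = E a v := by
    intro c
    obtain ⟨p, hp, hp'⟩ := block (A := MulAction.stabilizer A c) hft r hirr hr2 hcomm c.supp
      c.connected_toSimpleGraph (hnadj c) (σ.comp (Subgroup.subtype _))
      (fun a => hσ a) (by
        intro a i hi
        have h1 : σ a i ∈ σ a '' c.supp := ⟨i, hi, rfl⟩
        rw [hsupp, a.2] at h1
        exact h1)
      (fun a => E a) (fun a => hE a) (hq c.supp)
    exact ⟨p, hp, fun a ha v hv => hp' ⟨a, ha⟩ v hv⟩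
  choose p₀ hp₀ hp₀' using hblock
  let c₀ : G.ConnectedComponent → G.ConnectedComponent := fun c =>
    Quotient.out (Quotient.mk (MulAction.orbitRel A G.ConnectedComponent) c)
  have hc₀ : ∀ c, ∃ g : A, g • c₀ c = c := by
    intro c
    have h1 : (MulAction.orbitRel A G.ConnectedComponent) (c₀ c) c :=
      Quotient.exact (Quotient.out_eq _)
    exact (MulAction.orbitRel A G.ConnectedComponent).symm h1
  have hc₀a : ∀ (a : A) c, c₀ (a • c) = c₀ c := by
    intro a c
    have : Quotient.mk (MulAction.orbitRel A G.ConnectedComponent) (a • c) =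
        Quotient.mk (MulAction.orbitRel A G.ConnectedComponent) c :=
      Quotient.sound ⟨a, rfl⟩
    simp only [c₀, this]
  choose g hg using hc₀
  have htr : ∀ c, ∃ p', Good r c.supp p' ∧
      ∀ v, p' v = v ↔ p₀ (c₀ c) ((E (g c)).symm v) = (E (g c)).symm v := by
    intro c
    have := (hp₀ (c₀ c)).transport (σ (g c)) (E (g c)) (hE (g c))
    rwa [hsupp, hg] at this
  choose p hp hp' using htr
  have hmove : ∀ (a : A) c v, p c v = v → p (a • c) (E a v) = E a v := by
    intro a c v hv
    rw [hp'] at hv ⊢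
    rw [hc₀a]
    obtain ⟨u, rfl⟩ := (E (g c)).surjective v
    rw [LinearEquiv.symm_apply_apply] at hv
    obtain ⟨k, hk⟩ := prop1 a (g c)
    let h : A := (g (a • c))⁻¹ * (a * g c)
    have hh : a * g c = g (a • c) * h := by simp [h]
    obtain ⟨k', hk'⟩ := prop2 (g (a • c)) h
    have hst : h • c₀ c = c₀ c := by
      simp only [h, mul_smul]
      rw [hg, inv_smul_eq_iff, ← hc₀a a c, hg]
    have h1 := hp₀' (c₀ c) h hst u hv
    have h2 : (E (g (a • c))).symm (E a (E (g c) u)) = k • k' • E h u := by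
      rw [hk, hh, hk', map_smul, map_smul, LinearEquiv.symm_apply_apply]
    rw [h2, map_smul, map_smul, h1]
  have hfin : Finite G.ConnectedComponent := inferInstanceAs (Finite (Quot _))
  let : Fintype G.ConnectedComponent := Fintype.ofFinite _
  obtain ⟨P, hP, hP'⟩ := good_iUnion hirr (fun c : G.ConnectedComponent => c.supp) p hp
    (fun c i hi j hj => hcomm i j (hnadj c i hi j hj))
    (by
      intro c c' hcc
      rw [Set.disjoint_left]
      intro i hi hi'
      rw [SimpleGraph.ConnectedComponent.mem_supp_iff] at hi hi'
      exact hcc (hi.symm.trans hi')) Finset.univ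
  have huniv : (⋃ c ∈ (Finset.univ : Finset G.ConnectedComponent), c.supp) = Set.univ := by
    ext i
    simp
  rw [huniv] at hP
  obtain ⟨v₁, hv₁, hPv, hline⟩ := hP.rank_one hirr
  refine ⟨v₁, hv₁, fun a => hline _ ?_⟩
  rw [hP'] at hPv ⊢
  intro c _
  have := hmove a (a⁻¹ • c) v₁ (hPv _ (Finset.mem_univ _))
  rwa [smul_inv_smul] at this

lemma hom_of_line {ι A V : Type*} [Group A] [AddCommGroup V] [Module ℂ V]
    [FiniteDimensional ℂ V] (r : ι → Module.End ℂ V) (hirr : IrrFam r)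
    (σ : A →* Equiv.Perm ι)
    (E : A → (V ≃ₗ[ℂ] V)) (hE : ∀ a i v, E a (r i v) = r (σ a i) (E a v))
    (v₁ : V) (hv₁ : v₁ ≠ 0) (hl : ∀ a, ∃ c : ℂ, E a v₁ = c • v₁) :
    ∃ I : A →* (V ≃ₗ[ℂ] V), ∀ a, ∃ c : ℂ, ∀ v, I a v = c • E a v := by
  choose l hl using hl
  have hl0 : ∀ a, l a ≠ 0 := by
    intro a h0
    have := hl a
    rw [h0, zero_smul] at this
    exact hv₁ (by simpa using this)
  let I : A → (V ≃ₗ[ℂ] V) := fun a => (E a).trans (LinearEquiv.smulOfNeZero ℂ V (l a)⁻¹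
    (inv_ne_zero (hl0 a)))
  have hI : ∀ a v, I a v = (l a)⁻¹ • E a v := fun a v => rfl
  have hIr : ∀ a i v, I a (r i v) = r (σ a i) (I a v) := by
    intro a i v
    rw [hI, hI, hE, map_smul]
  have hI1 : ∀ a, I a v₁ = v₁ := by
    intro a
    rw [hI, hl, smul_smul, inv_mul_cancel₀ (hl0 a), one_smul]
  have hmul : ∀ a b, I (a * b) = I a * I b := by
    intro a b
    obtain ⟨k, hk⟩ := schur_prop hirr (σ (a * b)) (I (a * b)) ((I b).trans (I a)) (hIr _) (by
      intro i v
      simp only [LinearEquiv.trans_apply]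
      rw [hIr, hIr, map_mul, Equiv.Perm.mul_apply])
    have h1 := hk v₁
    rw [hI1, LinearEquiv.trans_apply, hI1, hI1] at h1
    have hk1 : k = 1 := by
      have h2 : (k - 1) • v₁ = 0 := by rw [sub_smul, ← h1, one_smul, sub_self]
      rcases smul_eq_zero.mp h2 with h3 | h3
      · exact sub_eq_zero.mp h3
      · exact absurd h3 hv₁
    ext v
    rw [hk, hk1, one_smul]
    rfl
  exact ⟨MonoidHom.mk' I hmul, fun a => ⟨(l a)⁻¹, hI a⟩⟩

end FinalPart

theorem stmt_14 {B W Γ V : Type*} [Group W] [Fintype W] {M : CoxeterMatrix B}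
    (cs : CoxeterSystem M W)
    (hcrys : ∀ i j : B, i ≠ j → M i j ∈ ({2, 3, 4, 6} : Set ℕ))
    [Group Γ] [Finite Γ] (act : Γ →* MulAut W)
    (hS : ∀ (γ : Γ) (i : B), ∃ j : B, act γ (cs.simple i) = cs.simple j)
    [AddCommGroup V] [Module ℂ V] (π : W →* (V →ₗ[ℂ] V)) (hπ : IsIrreducibleRep π) :
    ∃ I : isotropyGroup act π →* (V ≃ₗ[ℂ] V),
      ∀ (γ : isotropyGroup act π) (w : W) (v : V),
        (I γ) (π w v) = π (act (γ : Γ) w) ((I γ) v) := by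
  classical
  have hinj : Function.Injective cs.simple := cox_simple_injective cs hcrys
  have hBfin : Finite B := Finite.of_injective cs.simple hinj
  let _ : Fintype B := Fintype.ofFinite B
  have hpi : ∀ g g' v, π g (π g' v) = π (g * g') v := by
    intro g g' v; rw [map_mul]; rfl
  let r : B → Module.End ℂ V := fun i => π (cs.simple i)
  have hstab : ∀ K : Submodule ℂ V, (∀ i, ∀ v ∈ K, r i v ∈ K) → ∀ w, ∀ v ∈ K, π w v ∈ K := by
    intro K hK w
    induction w using cs.simple_induction with
    | simple i => exact hK i
    | one => intro v hv; simpa using hv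
    | mul w w' h h' => intro v hv; rw [← hpi]; exact h _ (h' _ hv)
  have hirr : IrrFam r := ⟨hπ.1, fun K hK => hπ.2 K (hstab K hK)⟩
  have hfd : FiniteDimensional ℂ V := by
    obtain ⟨v₀, hv₀⟩ := hπ.1
    let K := Submodule.span ℂ (Set.range fun w => π w v₀)
    have hK : ∀ w, ∀ v ∈ K, π w v ∈ K := by
      intro w v hv
      induction hv using Submodule.span_induction with
      | mem x hx =>
        obtain ⟨w', rfl⟩ := hx
        exact Submodule.subset_span ⟨w * w', (hpi w w' v₀).symm⟩
      | zero => simp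
      | add x y _ _ hx hy => rw [map_add]; exact K.add_mem hx hy
      | smul c x _ hx => rw [map_smul]; exact K.smul_mem c hx
    have hv₀K : v₀ ∈ K := Submodule.subset_span ⟨1, by simp⟩
    rcases hπ.2 K hK with h | h
    · rw [h] at hv₀K
      exact absurd ((Submodule.mem_bot ℂ).mp hv₀K) hv₀
    · exact Module.finite_def.mpr (h ▸ Submodule.fg_span (Set.finite_range _))
  have hr2 : ∀ i, r i * r i = 1 := by
    intro i
    change π _ * π _ = 1
    rw [← map_mul, cs.simple_mul_simple_self, map_one]
  have hcomm : ∀ i j, ¬ (coxGraph cs).Adj i j → r i * r j = r j * r i := by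
    intro i j hij
    have h1 : Commute (cs.simple i) (cs.simple j) := not_not.mp hij
    change π _ * π _ = π _ * π _
    rw [← map_mul, ← map_mul, h1.eq]
  choose s hs using hS
  have hs1 : ∀ i, s 1 i = i := by
    intro i
    apply hinj
    rw [← hs, map_one, MulAut.one_apply]
  have hsmul : ∀ a b i, s (a * b) i = s a (s b i) := by
    intro a b i
    apply hinj
    rw [← hs, ← hs, ← hs, map_mul, MulAut.mul_apply]
  let σ₀ : Γ →* Equiv.Perm B :=
    { toFun := fun a =>
        { toFun := s a
          invFun := s a⁻¹
          left_inv := fun i => by rw [← hsmul, inv_mul_cancel, hs1]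
          right_inv := fun i => by rw [← hsmul, mul_inv_cancel, hs1] }
      map_one' := by ext i; exact hs1 i
      map_mul' := by intro a b; ext i; exact hsmul a b i }
  have hσ₀ : ∀ a i, cs.simple (σ₀ a i) = act a (cs.simple i) := fun a i => (hs a i).symm
  let σ : isotropyGroup act π →* Equiv.Perm B := σ₀.comp (Subgroup.subtype _)
  have hσ : ∀ a i j, (coxGraph cs).Adj i j → (coxGraph cs).Adj (σ a i) (σ a j) := by
    intro a i j hij hc
    apply hij
    have h1 : Commute (cs.simple (σ₀ a i)) (cs.simple (σ₀ a j)) := hc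
    rw [hσ₀, hσ₀] at h1
    have h2 := h1.eq
    rw [← map_mul, ← map_mul] at h2
    exact (act (a : Γ)).injective h2
  choose E hE using fun a : isotropyGroup act π => a.2
  have hEr : ∀ a i v, E a (r i v) = r (σ a i) (E a v) := by
    intro a i v
    change E a (π _ v) = π (cs.simple (σ₀ a i)) (E a v)
    rw [hE, hσ₀]
  have hq : ∀ (D : Set B) (U : Submodule ℂ V), (∀ i ∈ D, ∀ v ∈ U, r i v ∈ U) →
      ∃ q : Module.End ℂ V, (∀ v, q v ∈ U) ∧ (∀ v ∈ U, q v = v) ∧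
        ∀ i ∈ D, q * r i = r i * q := by
    intro D U hU
    obtain ⟨q, h1, h2, h3⟩ := average π (Subgroup.closure (cs.simple '' D)) U (by
      intro h hh
      have hinv : ∀ x : W, (∀ v ∈ U, π x v ∈ U) → ∀ v ∈ U, π x⁻¹ v ∈ U := by
        intro x hx v hv
        have hpow : ∀ n : ℕ, ∀ v ∈ U, π (x ^ n) v ∈ U := by
          intro n
          induction n with
          | zero => intro v hv; simpa using hv
          | succ n ih => intro v hv; rw [pow_succ, ← hpi]; exact ih _ (hx v hv)
        have hx1 : x⁻¹ = x ^ (orderOf x - 1) := by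
          rw [inv_eq_iff_mul_eq_one, ← pow_succ', Nat.sub_add_cancel (orderOf_pos x),
            pow_orderOf_eq_one]
        rw [hx1]
        exact hpow _ v hv
      induction hh using Subgroup.closure_induction with
      | mem x hx => obtain ⟨i, hi, rfl⟩ := hx; exact hU i hi
      | one => intro v hv; simpa using hv
      | mul x y _ _ hx hy => intro v hv; rw [← hpi]; exact hx _ (hy _ hv)
      | inv x _ hx => exact hinv x hx)
    exact ⟨q, h1, h2, fun i hi => h3 _ (Subgroup.subset_closure ⟨i, hi, rfl⟩)⟩
  obtain ⟨v₁, hv₁, hl⟩ :=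
    exists_line (coxGraph_finType cs hcrys) r hirr hr2 hcomm σ hσ E hEr hq
  obtain ⟨I, hI⟩ := hom_of_line r hirr σ E hEr v₁ hv₁ hl
  refine ⟨I, fun a w v => ?_⟩
  obtain ⟨c, hc⟩ := hI a
  rw [hc, hc, hE, map_smul]
end
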